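/- There exists a finite 4-regular planar straight-line unit-distance graph in the Euclidean plane consisting only of unit triangles without additional triangles, having exactly 9200 = 100·92 unit triangles, which is invariant under the rotation about some center point by the angle 2π/100; i.e., it is a rigid planar ring graph with rotational symmetry of order 100. -/

import Mathlib

/-!
Straight-line unit-distance graphs in the Euclidean plane, modelled as ℂ.
-/

noncomputable section
open scoped Classical

/-- A finite straight-line unit-distance graph in the plane: a finite vertex
set `V ⊆ ℂ` and a finite set `E` of 2-element subsets of `V` (edges), each of
whose two endpoints are at distance one. -/
structure UnitDistGraph where
  V : Finset ℂ
  E : Finset (Finset ℂ)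
  edge_sub : ∀ e ∈ E, e ⊆ V
  edge_pair : ∀ e ∈ E, ∃ x y : ℂ, x ≠ y ∧ e = {x, y} ∧ dist x y = 1

namespace UnitDistGraph

/-- The closed segment drawn for an edge (the convex hull of its two endpoints). -/
def edgeSeg (e : Finset ℂ) : Set ℂ := convexHull ℝ (e : Set ℂ)

/-- The degree of a vertex: the number of edges containing it. -/
def degree (G : UnitDistGraph) (v : ℂ) : ℕ := {e | e ∈ G.E ∧ v ∈ e}.ncard

/-- The graph is drawn planarly: two distinct closed edge segments intersect in
at most a common endpoint, and no vertex lies in the relative interior of an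
edge (i.e. a vertex on a closed edge segment is an endpoint of that edge). -/
def Planar (G : UnitDistGraph) : Prop :=
  (∀ e ∈ G.E, ∀ f ∈ G.E, e ≠ f →
    edgeSeg e ∩ edgeSeg f ⊆ (e : Set ℂ) ∩ (f : Set ℂ)) ∧
  (∀ v ∈ G.V, ∀ e ∈ G.E, v ∈ edgeSeg e → v ∈ e)

/-- The graph is 4-regular: every vertex belongs to exactly 4 edges. -/
def Regular4 (G : UnitDistGraph) : Prop := ∀ v ∈ G.V, G.degree v = 4

/-- A unit triangle: a 3-element subset of `V` all of whose pairs are edges. -/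
def IsUnitTriangle (G : UnitDistGraph) (t : Finset ℂ) : Prop :=
  t ⊆ G.V ∧ t.card = 3 ∧ ∀ x ∈ t, ∀ y ∈ t, x ≠ y → ({x, y} : Finset ℂ) ∈ G.E

/-- The number of unit triangles of the graph. -/
def triangleCount (G : UnitDistGraph) : ℕ := {t : Finset ℂ | G.IsUnitTriangle t}.ncard

/-- The graph consists only of unit triangles: every edge lies in a unit triangle. -/
def OnlyUnitTriangles (G : UnitDistGraph) : Prop :=
  ∀ e ∈ G.E, ∃ t : Finset ℂ, G.IsUnitTriangle t ∧ e ⊆ t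

/-- The closed segment from `x` to `y` is a union of closed edge segments of `E`. -/
def SideCovered (G : UnitDistGraph) (x y : ℂ) : Prop :=
  ∃ S : Finset (Finset ℂ), S ⊆ G.E ∧ segment ℝ x y = ⋃ e ∈ S, edgeSeg e

/-- No additional triangles: any equilateral triangle on vertices of `V` each of
whose sides is a union of closed edge segments has side length 1. -/
def NoAdditionalTriangles (G : UnitDistGraph) : Prop :=
  ∀ x ∈ G.V, ∀ y ∈ G.V, ∀ z ∈ G.V, x ≠ y → y ≠ z → x ≠ z →
    dist x y = dist y z → dist y z = dist z x →
    G.SideCovered x y → G.SideCovered y z → G.SideCovered z x →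
    dist x y = 1

end UnitDistGraph

open UnitDistGraph

namespace UnitDistGraph

/-- Rotation of the plane about the center `c` by the angle `θ`. -/
def rot (c : ℂ) (θ : ℝ) (z : ℂ) : ℂ := c + Complex.exp (θ * Complex.I) * (z - c)

/-- The graph is invariant under the rotation about `c` by `θ`: this rotation
maps the vertex set onto itself and the edge set onto itself. -/
def RotInvariant (G : UnitDistGraph) (c : ℂ) (θ : ℝ) : Prop :=
  (rot c θ) '' (G.V : Set ℂ) = (G.V : Set ℂ) ∧
  (Finset.image (rot c θ)) '' (G.E : Set (Finset ℂ)) = (G.E : Set (Finset ℂ))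

/-- The unit triangles of the graph are non-overlapping: the interiors of the
closed triangular regions of two distinct unit triangles are disjoint. -/
def NonOverlapping (G : UnitDistGraph) : Prop :=
  ∀ t₁ t₂ : Finset ℂ, G.IsUnitTriangle t₁ → G.IsUnitTriangle t₂ → t₁ ≠ t₂ →
    interior (convexHull ℝ (t₁ : Set ℂ)) ∩ interior (convexHull ℝ (t₂ : Set ℂ)) = ∅

/-- The line through the point `c` with direction `d`. -/
def line (c d : ℂ) : Set ℂ := {z : ℂ | ∃ t : ℝ, z = c + (t : ℂ) * d}

/-- Two unit-distance graphs are congruent if some isometry of the plane maps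
the vertex set and edge set of one onto those of the other. -/
def Congruent (G₁ G₂ : UnitDistGraph) : Prop :=
  ∃ φ : ℂ ≃ᵢ ℂ, G₁.V.image φ = G₂.V ∧ G₁.E.image (Finset.image φ) = G₂.E

end UnitDistGraph

/-- The dihedral group of order `2 * n` acting on the plane `ℂ` by rotations through multiples of
`2π/n` and the reflection in the real axis. -/
def dihedralIsometry (n : ℕ) [NeZero n] : DihedralGroup n →* (ℂ ≃ₗᵢ[ℝ] ℂ) where
  toFun
    | .r j => rotation (ZMod.toCircle j)
    | .sr j => Complex.conjLIE * rotation (ZMod.toCircle j)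
  map_one' := by
    change rotation (ZMod.toCircle 0) = 1
    simp
  map_mul' := by
    have hcomm : ∀ i : ZMod n, rotation (ZMod.toCircle i) * Complex.conjLIE =
        Complex.conjLIE * rotation (ZMod.toCircle (-i)) := by
      intro i
      ext z
      simp only [LinearIsometryEquiv.coe_mul, Function.comp_apply, rotation_apply,
        Complex.conjLIE_apply, map_mul, AddChar.map_neg_eq_inv, Circle.coe_inv_eq_conj,
        Complex.conj_conj]
    have hconj : (Complex.conjLIE * Complex.conjLIE : ℂ ≃ₗᵢ[ℝ] ℂ) = 1 := by
      ext z
      simp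
    rintro (i | i) (j | j)
    · simp only [DihedralGroup.r_mul_r, AddChar.map_add_eq_mul, map_mul]
    · simp only [DihedralGroup.r_mul_sr]
      rw [← mul_assoc, hcomm, mul_assoc, ← map_mul, ← AddChar.map_add_eq_mul, neg_add_eq_sub]
    · simp only [DihedralGroup.sr_mul_r, AddChar.map_add_eq_mul, map_mul, mul_assoc]
    · simp only [DihedralGroup.sr_mul_sr]
      rw [mul_assoc, ← mul_assoc (rotation _), hcomm, mul_assoc, ← mul_assoc, hconj, one_mul,
        ← map_mul, ← AddChar.map_add_eq_mul, neg_add_eq_sub]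

section DihedralIsometry

variable {n : ℕ}

/-- The sector of the plane between the positive real axis and the ray at angle `π/n`. -/
def InSector (n : ℕ) (z : ℂ) : Prop :=
  0 < z.re ∧ 0 ≤ z.im ∧ Real.cos (Real.pi / n) * z.im ≤ Real.sin (Real.pi / n) * z.re

/-- A point on one of the two lines bounding the sector. -/
def OnMirror (n : ℕ) (z : ℂ) : Prop :=
  z.im = 0 ∨ Real.cos (Real.pi / n) * z.im = Real.sin (Real.pi / n) * z.re

theorem InSector.arg_mem {z : ℂ} (hn : 2 ≤ n) (hz : InSector n z) :
    0 ≤ z.arg ∧ z.arg ≤ Real.pi / n := by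
  obtain ⟨h1, h2, h3⟩ := hz
  have hn' : (2 : ℝ) ≤ n := by exact_mod_cast hn
  have hpi := Real.pi_pos
  have hθ : Real.pi / n ≤ Real.pi / 2 := by gcongr
  have hθ0 : 0 < Real.pi / n := by positivity
  have h0 : 0 ≤ z.arg := Complex.arg_nonneg_iff.2 h2
  refine ⟨h0, ?_⟩
  by_contra! hlt
  have hz0 : 0 < ‖z‖ := norm_pos_iff.2 fun h => by simp [h] at h1
  have hpos : 0 < Real.sin (z.arg - Real.pi / n) :=
    Real.sin_pos_of_pos_of_lt_pi (by linarith) (by linarith [Complex.arg_le_pi z])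
  rw [Real.sin_sub] at hpos
  have := mul_pos hz0 hpos
  have e1 := Complex.norm_mul_cos_arg z
  have e2 := Complex.norm_mul_sin_arg z
  have e : ‖z‖ * (Real.sin z.arg * Real.cos (Real.pi / n) -
      Real.cos z.arg * Real.sin (Real.pi / n)) =
      Real.cos (Real.pi / n) * z.im - Real.sin (Real.pi / n) * z.re := by
    rw [← e1, ← e2]
    ring
  linarith

theorem InSector.onMirror_left {z : ℂ} (h : z.arg = 0) : z.im = 0 :=
  (Complex.arg_eq_zero_iff.1 h).2.symm ▸ rfl

theorem onMirror_right {z : ℂ} (h : z.arg = Real.pi / n) :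
    Real.cos (Real.pi / n) * z.im = Real.sin (Real.pi / n) * z.re := by
  have e1 := Complex.norm_mul_cos_arg z
  have e2 := Complex.norm_mul_sin_arg z
  rw [← e1, ← e2, h]
  ring

theorem dihedralGroup_sr_ne_one (j : ZMod n) : (DihedralGroup.sr j) ≠ 1 := by
  rw [DihedralGroup.one_def]
  exact nofun

variable [NeZero n]

theorem dihedralIsometry_r (j : ZMod n) (z : ℂ) :
    dihedralIsometry n (.r j) z = Complex.exp ((2 * (Real.pi / n) * j.val : ℝ) * Complex.I) * z := by
  change (ZMod.toCircle j : ℂ) * z = _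
  rw [ZMod.toCircle_apply]
  congr 2
  push_cast
  ring

theorem dihedralIsometry_sr (j : ZMod n) (z : ℂ) :
    dihedralIsometry n (.sr j) z = starRingEnd ℂ
      (Complex.exp ((2 * (Real.pi / n) * j.val : ℝ) * Complex.I) * z) := by
  rw [← dihedralIsometry_r]
  rfl

/-- The sector is a strict fundamental domain: a dihedral isometry sending a point of the sector
to a point of the sector fixes it, and is trivial or a reflection in a side through the point. -/
theorem dihedralIsometry_fundamental (hn : 2 ≤ n) {z z' : ℂ} (hz : InSector n z)
    (hz' : InSector n z') {g : DihedralGroup n} (hg : dihedralIsometry n g z' = z) :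
    z' = z ∧ (g = 1 ∨ (z.im = 0 ∧ g = .sr 0) ∨
      (Real.cos (Real.pi / n) * z.im = Real.sin (Real.pi / n) * z.re ∧ g = .sr (-1))) := by
  have hn' : (2 : ℝ) ≤ n := by exact_mod_cast hn
  have hn0 : (n : ℝ) ≠ 0 := by positivity
  have hpi := Real.pi_pos
  obtain ⟨h0, h1⟩ := hz.arg_mem hn
  obtain ⟨h0', h1'⟩ := hz'.arg_mem hn
  have hnorm : ‖z'‖ = ‖z‖ := by rw [← hg, LinearIsometryEquiv.norm_map]
  have hz0 : z ≠ 0 := fun h => by simpa [h] using hz.1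
  have hr0 : (‖z‖ : ℂ) ≠ 0 := by simpa using hz0
  set θ := Real.pi / n with hθ
  have hθ0 : 0 < θ := by positivity
  have hnθ : (n : ℝ) * θ = Real.pi := by rw [hθ]; field_simp
  have heq_of_arg : z'.arg = z.arg → z' = z := fun h => Complex.ext_norm_arg hnorm h
  have hzz := Complex.norm_mul_exp_arg_mul_I z
  have hzz' := Complex.norm_mul_exp_arg_mul_I z'
  rcases g with j | j
  · rw [dihedralIsometry_r] at hg
    have hj : j.val < n := ZMod.val_lt j
    have hj' : (j.val : ℝ) + 1 ≤ n := by exact_mod_cast hj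
    rw [← hzz', ← hzz, hnorm, mul_left_comm, ← Complex.exp_add] at hg
    have hg' := mul_left_cancel₀ hr0 hg
    rw [Complex.exp_eq_exp_iff_exists_int] at hg'
    obtain ⟨m, hm⟩ := hg'
    have hm' : 2 * θ * j.val + z'.arg = z.arg + m * (2 * Real.pi) := by
      have := congrArg Complex.im hm
      simpa using this
    have hjv : (0 : ℝ) ≤ j.val := by positivity
    have hm0 : m = 0 := by
      have ha : (m : ℝ) < 1 := by
        by_contra! hge
        nlinarith [mul_le_mul_of_nonneg_left hj' hθ0.le]
      have hb : (-1 : ℝ) < m := by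
        by_contra! hge
        nlinarith [mul_nonneg hθ0.le hjv]
      have ha' : m < 1 := by exact_mod_cast ha
      have hb' : -1 < m := by exact_mod_cast hb
      omega
    have hj0 : j.val = 0 := by
      by_contra hne
      have : (1 : ℝ) ≤ j.val := by exact_mod_cast Nat.one_le_iff_ne_zero.2 hne
      rw [hm0] at hm'
      push_cast at hm'
      nlinarith
    refine ⟨heq_of_arg ?_, Or.inl ?_⟩
    · rw [hm0, hj0] at hm'
      push_cast at hm'
      linarith
    · rw [(ZMod.val_eq_zero j).1 hj0, DihedralGroup.r_zero]
  · rw [dihedralIsometry_sr] at hg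
    have hj : j.val < n := ZMod.val_lt j
    have hj' : (j.val : ℝ) + 1 ≤ n := by exact_mod_cast hj
    rw [← hzz', ← hzz, hnorm, mul_left_comm, ← Complex.exp_add, map_mul, Complex.conj_ofReal,
      ← Complex.exp_conj] at hg
    have hg' := mul_left_cancel₀ hr0 hg
    rw [Complex.exp_eq_exp_iff_exists_int] at hg'
    obtain ⟨m, hm⟩ := hg'
    have hm' : -(2 * θ * j.val) - z'.arg = z.arg + m * (2 * Real.pi) := by
      have := congrArg Complex.im hm
      simp only [map_add, map_mul, Complex.conj_I, Complex.conj_ofReal] at this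
      simp [-ZMod.natCast_val] at this
      linarith
    have hjv : (0 : ℝ) ≤ j.val := by positivity
    have hm0 : m = 0 ∨ m = -1 := by
      have ha : (m : ℝ) < 1 := by
        by_contra! hge
        nlinarith [mul_nonneg hθ0.le hjv]
      have hb : (-2 : ℝ) < m := by
        by_contra! hge
        nlinarith [mul_le_mul_of_nonneg_left hj' hθ0.le]
      have ha' : m < 1 := by exact_mod_cast ha
      have hb' : -2 < m := by exact_mod_cast hb
      omega
    rcases hm0 with rfl | rfl
    · push_cast at hm'
      have h3 := mul_nonneg hθ0.le hjv
      have hj0 : j.val = 0 := by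
        by_contra hne
        have : (1 : ℝ) ≤ j.val := by exact_mod_cast Nat.one_le_iff_ne_zero.2 hne
        nlinarith
      have ha : z.arg = 0 := by linarith
      refine ⟨heq_of_arg (by linarith), Or.inr (Or.inl ⟨?_, ?_⟩)⟩
      · exact InSector.onMirror_left ha
      · rw [(ZMod.val_eq_zero j).1 hj0]
    · push_cast at hm'
      have hjn : j.val + 1 = n := by
        by_contra hne
        have : (j.val : ℝ) + 2 ≤ n := by
          have : j.val + 2 ≤ n := by omega
          exact_mod_cast this
        nlinarith
      have hjr : (j.val : ℝ) + 1 = n := by exact_mod_cast hjn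
      have hsum : z'.arg + z.arg = 2 * θ := by
        have : (j.val : ℝ) = n - 1 := by linarith
        rw [this] at hm'
        linarith
      have ha : z.arg = θ := by linarith
      refine ⟨heq_of_arg (by linarith), Or.inr (Or.inr ⟨onMirror_right ha, ?_⟩)⟩
      have : ((j.val + 1 : ℕ) : ZMod n) = 0 := by rw [hjn]; simp
      rw [Nat.cast_add, ZMod.natCast_zmod_val, Nat.cast_one] at this
      rw [eq_neg_of_add_eq_zero_left this]

theorem dihedralIsometry_sr_zero {z : ℂ} (h : z.im = 0) : dihedralIsometry n (.sr 0) z = z := by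
  rw [dihedralIsometry_sr]
  simpa using Complex.conj_eq_iff_im.2 h

theorem dihedralIsometry_sr_neg_one {z : ℂ}
    (h : Real.cos (Real.pi / n) * z.im = Real.sin (Real.pi / n) * z.re) :
    dihedralIsometry n (.sr (-1)) z = z := by
  change starRingEnd ℂ ((ZMod.toCircle (-1 : ZMod n) : ℂ) * z) = z
  have h1 := ZMod.toCircle_natCast (N := n) 1
  rw [AddChar.map_neg_eq_inv, Circle.coe_inv_eq_conj, map_mul, Complex.conj_conj]
  rw [Nat.cast_one] at h1
  rw [h1]
  have h2 : Complex.exp (2 * Real.pi * Complex.I * (1 : ℕ) / n) =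
      Complex.exp ((2 * (Real.pi / n) : ℝ) * Complex.I) := by
    congr 1
    push_cast
    ring
  rw [h2]
  have hc := Real.sin_sq_add_cos_sq (Real.pi / n)
  apply Complex.ext
  · rw [Complex.mul_re, Complex.exp_ofReal_mul_I_re, Complex.exp_ofReal_mul_I_im, Complex.conj_re,
      Complex.conj_im, Real.cos_two_mul, Real.sin_two_mul]
    linear_combination (2 * Real.sin (Real.pi / n)) * h + 2 * z.re * hc
  · rw [Complex.mul_im, Complex.exp_ofReal_mul_I_re, Complex.exp_ofReal_mul_I_im, Complex.conj_re,
      Complex.conj_im, Real.cos_two_mul, Real.sin_two_mul]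
    linear_combination (-2 * Real.cos (Real.pi / n)) * h

end DihedralIsometry

/-- A planar straight-line unit-distance graph drawn in the sector of angle `π/n`, whose images
under the dihedral group fit together to a `4`-regular ring. -/
structure RingWedge (n : ℕ) (ι : Type) where
  pos : ι → ℂ
  adj : ι → ι → Prop
  symm : ∀ {a b}, adj a b → adj b a
  inSector : ∀ a, InSector n (pos a)
  injective : Function.Injective pos
  dist_eq : ∀ {a b}, adj a b → dist (pos a) (pos b) = 1
  not_mirror : ∀ {a b}, adj a b → OnMirror n (pos a) → ¬ OnMirror n (pos b)
  planar : ∀ {a b c d}, adj a b → adj c d → ({a, b} : Set ι) ≠ {c, d} →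
    ∀ z ∈ segment ℝ (pos a) (pos b), z ∈ segment ℝ (pos c) (pos d) →
      (z = pos a ∨ z = pos b) ∧ (z = pos c ∨ z = pos d)
  degree_interior : ∀ a, ¬ OnMirror n (pos a) → {b | adj a b}.ncard = 4
  degree_mirror : ∀ a, OnMirror n (pos a) → {b | adj a b}.ncard = 2
  bent_interior : ∀ {a b c}, ¬ OnMirror n (pos a) → adj a b → adj a c →
    pos b + pos c ≠ 2 * pos a
  bent_mirror : ∀ {a b c}, OnMirror n (pos a) → adj a b → adj a c →
    inner ℝ (pos a) (pos b + pos c - 2 * pos a) ≠ 0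
  exists_triangle : ∀ {a b}, adj a b → ∃ c, adj a c ∧ adj b c

namespace RingWedge

variable {n : ℕ} {ι : Type} {W : RingWedge n ι}

theorem ne_of_adj {a b : ι} (h : W.adj a b) : a ≠ b := by
  rintro rfl
  simpa using W.dist_eq h

theorem exists_adj (a : ι) : ∃ b, W.adj a b := by
  by_cases ha : OnMirror n (W.pos a)
  · exact Set.nonempty_of_ncard_ne_zero (s := {b | W.adj a b})
      (by rw [W.degree_mirror a ha]; norm_num)
  · exact Set.nonempty_of_ncard_ne_zero (s := {b | W.adj a b})
      (by rw [W.degree_interior a ha]; norm_num)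

theorem inSector_of_mem_segment {z w x : ℂ} (hz : InSector n z) (hw : InSector n w)
    (hx : x ∈ segment ℝ z w) : InSector n x := by
  obtain ⟨s, t, hs, ht, hst, rfl⟩ := hx
  obtain ⟨h1, h2, h3⟩ := hz
  obtain ⟨h1', h2', h3'⟩ := hw
  simp only [InSector, Complex.add_re, Complex.add_im, Complex.real_smul, Complex.re_ofReal_mul,
    Complex.im_ofReal_mul]
  have h4 := mul_le_mul_of_nonneg_left h3 hs
  have h4' := mul_le_mul_of_nonneg_left h3' ht
  refine ⟨?_, by positivity, by linarith⟩
  rcases hs.eq_or_lt with rfl | hs'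
  · have : t = 1 := by linarith
    subst this
    simpa using h1'
  · have := mul_pos hs' h1
    have := mul_nonneg ht h1'.le
    linarith

theorem endpoint_of_onMirror {a b : ι} (hab : W.adj a b) {z : ℂ}
    (hz : z ∈ segment ℝ (W.pos a) (W.pos b)) (hm : OnMirror n z) :
    z = W.pos a ∨ z = W.pos b := by
  have key : ∀ p q : ℝ, 0 ≤ p → 0 ≤ q → (p ≠ 0 ∨ q ≠ 0) → ∀ s t : ℝ, 0 ≤ s → 0 ≤ t →
      s * p + t * q = 0 → s = 0 ∨ t = 0 := by
    intro p q hp hq hpq s t hs ht h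
    have h1 : s * p = 0 := by nlinarith [mul_nonneg hs hp, mul_nonneg ht hq]
    have h2 : t * q = 0 := by nlinarith [mul_nonneg hs hp, mul_nonneg ht hq]
    rcases hpq with h' | h'
    · exact Or.inl ((mul_eq_zero.1 h1).resolve_right h')
    · exact Or.inr ((mul_eq_zero.1 h2).resolve_right h')
  obtain ⟨s, t, hs, ht, hst, rfl⟩ := hz
  obtain ⟨-, h2, h3⟩ := W.inSector a
  obtain ⟨-, h2', h3'⟩ := W.inSector b
  have hnm := W.not_mirror hab
  have hst' : s = 0 ∨ t = 0 := by
    simp only [OnMirror, Complex.add_re, Complex.add_im, Complex.real_smul, Complex.re_ofReal_mul,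
      Complex.im_ofReal_mul] at hm hnm
    rcases hm with hm | hm
    · refine key _ _ h2 h2' ?_ s t hs ht hm
      by_contra! hcon
      exact hnm (Or.inl hcon.1) (Or.inl hcon.2)
    · refine key _ _ (sub_nonneg.2 h3) (sub_nonneg.2 h3') ?_ s t hs ht (by linarith)
      by_contra! hcon
      exact hnm (Or.inr (by linarith [hcon.1])) (Or.inr (by linarith [hcon.2]))
  rcases hst' with rfl | rfl
  · right
    have : t = 1 := by linarith
    simp [this]
  · left
    have : s = 1 := by linarith
    simp [this]

variable [NeZero n]

variable (W) in
/-- The copy of a vertex of the wedge in the image of the wedge under a dihedral isometry. -/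
def point (g : DihedralGroup n) (a : ι) : ℂ := dihedralIsometry n g (W.pos a)

theorem point_mul (g h : DihedralGroup n) (a : ι) :
    W.point (g * h) a = dihedralIsometry n g (W.point h a) := by
  simp [point]

theorem point_injective (g : DihedralGroup n) : Function.Injective (W.point g) :=
  (dihedralIsometry n g).injective.comp W.injective

theorem point_eq_point (hn : 2 ≤ n) {g h : DihedralGroup n} {a b : ι}
    (hp : W.point g a = W.point h b) :
    a = b ∧ (g = h ∨ (OnMirror n (W.pos a) ∧ ((W.pos a).im = 0 ∧ g⁻¹ * h = .sr 0 ∨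
      (Real.cos (Real.pi / n) * (W.pos a).im = Real.sin (Real.pi / n) * (W.pos a).re ∧
        g⁻¹ * h = .sr (-1))))) := by
  have h1 : dihedralIsometry n (g⁻¹ * h) (W.pos b) = W.pos a := by
    change W.point _ _ = _
    rw [point_mul, ← hp, ← point_mul, inv_mul_cancel]
    simp [point]
  obtain ⟨h2, h3⟩ := dihedralIsometry_fundamental hn (W.inSector a) (W.inSector b) h1
  refine ⟨(W.injective h2).symm, ?_⟩
  rcases h3 with h3 | h3 | h3
  · exact Or.inl (inv_mul_eq_one.1 h3)
  · exact Or.inr ⟨Or.inl h3.1, Or.inl h3⟩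
  · exact Or.inr ⟨Or.inr h3.1, Or.inr h3⟩

theorem eq_of_point_eq_point (hn : 2 ≤ n) {g h : DihedralGroup n} {a b : ι}
    (hp : W.point g a = W.point h b) (ha : ¬ OnMirror n (W.pos a)) : g = h :=
  (point_eq_point hn hp).2.resolve_right fun h => ha h.1

variable (W) in
/-- The neighbours of a vertex of the wedge in the whole ring. -/
def nbrs (a : ι) : Set ℂ :=
  {q | ∃ h : DihedralGroup n, W.point h a = W.pos a ∧ ∃ b, W.adj a b ∧ q = W.point h b}

theorem point_one (a : ι) : W.point 1 a = W.pos a := by simp [point]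

theorem stabilizer_interior (hn : 2 ≤ n) {a : ι} (ha : ¬ OnMirror n (W.pos a))
    {h : DihedralGroup n} (hh : W.point h a = W.pos a) : h = 1 :=
  (eq_of_point_eq_point hn ((point_one a).trans hh.symm) ha).symm

theorem exists_stabilizer_mirror (hn : 2 ≤ n) {a : ι} (ha : OnMirror n (W.pos a)) :
    ∃ σ : DihedralGroup n, σ ≠ 1 ∧ ∀ h, W.point h a = W.pos a ↔ (h = 1 ∨ h = σ) := by
  have hn' : (2 : ℝ) ≤ n := by exact_mod_cast hn
  have hpi := Real.pi_pos
  have hθ : Real.pi / n ≤ Real.pi / 2 := by gcongr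
  have hθ0 : 0 < Real.pi / n := by positivity
  have hs : 0 < Real.sin (Real.pi / n) := Real.sin_pos_of_pos_of_lt_pi hθ0 (by linarith)
  have hre := mul_pos hs (W.inSector a).1
  have hcases : ∀ h, W.point h a = W.pos a → h = 1 ∨ ((W.pos a).im = 0 ∧ h = .sr 0 ∨
      (Real.cos (Real.pi / n) * (W.pos a).im = Real.sin (Real.pi / n) * (W.pos a).re ∧
        h = .sr (-1))) := by
    intro h hh
    have := (point_eq_point hn ((point_one a).trans hh.symm)).2
    simp only [inv_one, one_mul] at this
    rcases this with h1 | h1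
    · exact Or.inl h1.symm
    · exact Or.inr h1.2
  rcases ha with ha | ha
  · refine ⟨.sr 0, dihedralGroup_sr_ne_one 0, fun h => ⟨fun hh => ?_, ?_⟩⟩
    · rcases hcases h hh with h1 | h1 | h1
      · exact Or.inl h1
      · exact Or.inr h1.2
      · rw [← h1.1, ha, mul_zero] at hre
        exact (lt_irrefl _ hre).elim
    · rintro (rfl | rfl)
      · exact point_one a
      · exact dihedralIsometry_sr_zero ha
  · refine ⟨.sr (-1), dihedralGroup_sr_ne_one _, fun h => ⟨fun hh => ?_, ?_⟩⟩
    · rcases hcases h hh with h1 | h1 | h1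
      · exact Or.inl h1
      · rw [← ha, h1.1, mul_zero] at hre
        exact (lt_irrefl _ hre).elim
      · exact Or.inr h1.2
    · rintro (rfl | rfl)
      · exact point_one a
      · exact dihedralIsometry_sr_neg_one ha

theorem ncard_nbrs (hn : 2 ≤ n) [Finite ι] (a : ι) : (W.nbrs a).ncard = 4 := by
  by_cases ha : OnMirror n (W.pos a)
  · obtain ⟨σ, hσ, hstab⟩ := exists_stabilizer_mirror hn ha
    have hset : W.nbrs a = W.point 1 '' {b | W.adj a b} ∪ W.point σ '' {b | W.adj a b} := by
      ext q
      simp only [nbrs, hstab, Set.mem_ofPred_eq, Set.mem_union, Set.mem_image]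
      constructor
      · rintro ⟨h, rfl | rfl, b, hb, rfl⟩
        · exact Or.inl ⟨b, hb, rfl⟩
        · exact Or.inr ⟨b, hb, rfl⟩
      · rintro (⟨b, hb, rfl⟩ | ⟨b, hb, rfl⟩)
        · exact ⟨1, Or.inl rfl, b, hb, rfl⟩
        · exact ⟨σ, Or.inr rfl, b, hb, rfl⟩
    rw [hset, Set.ncard_union_eq, Set.ncard_image_of_injective _ (point_injective _),
      Set.ncard_image_of_injective _ (point_injective _), W.degree_mirror a ha]
    rw [Set.disjoint_left]
    rintro _ ⟨b, hb, rfl⟩ ⟨c, hc, hbc⟩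
    exact hσ (eq_of_point_eq_point hn hbc (W.not_mirror hc ha))
  · have hset : W.nbrs a = W.point 1 '' {b | W.adj a b} := by
      ext q
      constructor
      · rintro ⟨h, hh, b, hb, rfl⟩
        rw [stabilizer_interior hn ha hh]
        exact ⟨b, hb, rfl⟩
      · rintro ⟨b, hb, rfl⟩
        exact ⟨1, point_one a, b, hb, rfl⟩
    rw [hset, Set.ncard_image_of_injective _ (point_injective _), W.degree_interior a ha]

theorem nbrs_bent (hn : 2 ≤ n) {a : ι} {q r : ℂ} (hq : q ∈ W.nbrs a) (hr : r ∈ W.nbrs a) :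
    q + r ≠ 2 * W.pos a := by
  obtain ⟨h, hh, b, hb, rfl⟩ := hq
  obtain ⟨k, hk, c, hc, rfl⟩ := hr
  intro heq
  by_cases ha : OnMirror n (W.pos a)
  · have hinner : ∀ (h : DihedralGroup n) (b : ι), W.point h a = W.pos a →
        inner ℝ (W.pos a) (W.point h b) = inner ℝ (W.pos a) (W.pos b) := by
      intro h b hh
      conv_lhs => rw [← hh]
      exact LinearIsometryEquiv.inner_map_map _ _ _
    apply W.bent_mirror ha hb hc
    rw [inner_sub_right, inner_add_right, ← hinner h b hh, ← hinner k c hk, ← inner_add_right,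
      ← inner_sub_right, heq, sub_self, inner_zero_right]
  · rw [stabilizer_interior hn ha hh, stabilizer_interior hn ha hk, point_one, point_one] at heq
    exact W.bent_interior ha hb hc heq

theorem edgeSeg_pair (x y : ℂ) : edgeSeg {x, y} = segment ℝ x y := by
  rw [edgeSeg, Finset.coe_pair, convexHull_pair]

theorem segment_point (g : DihedralGroup n) (a b : ι) :
    segment ℝ (W.point g a) (W.point g b) =
      dihedralIsometry n g '' segment ℝ (W.pos a) (W.pos b) :=
  (image_segment ℝ (dihedralIsometry n g).toLinearEquiv.toLinearMap.toAffineMap _ _).symm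

variable [Fintype ι]

variable (W) in
/-- The ring graph: the union of the images of the wedge under the dihedral isometries. -/
def graph : UnitDistGraph where
  V := Finset.univ.image fun x : DihedralGroup n × ι => W.point x.1 x.2
  E := (Finset.univ.filter fun x : DihedralGroup n × ι × ι => W.adj x.2.1 x.2.2).image
    fun x => {W.point x.1 x.2.1, W.point x.1 x.2.2}
  edge_sub := by
    intro e he
    simp only [Finset.mem_image, Finset.mem_filter, Finset.mem_univ, true_and] at he
    obtain ⟨⟨g, a, b⟩, -, rfl⟩ := he
    intro v hv
    simp only [Finset.mem_insert, Finset.mem_singleton] at hv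
    rcases hv with rfl | rfl
    · exact Finset.mem_image_of_mem (fun x : DihedralGroup n × ι => W.point x.1 x.2)
        (Finset.mem_univ (g, a))
    · exact Finset.mem_image_of_mem (fun x : DihedralGroup n × ι => W.point x.1 x.2)
        (Finset.mem_univ (g, b))
  edge_pair := by
    intro e he
    simp only [Finset.mem_image, Finset.mem_filter, Finset.mem_univ, true_and] at he
    obtain ⟨⟨g, a, b⟩, hab, rfl⟩ := he
    refine ⟨_, _, (point_injective g).ne (ne_of_adj hab), rfl, ?_⟩
    exact ((dihedralIsometry n g).dist_map _ _).trans (W.dist_eq hab)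

theorem mem_V {v : ℂ} : v ∈ W.graph.V ↔ ∃ g a, v = W.point g a := by
  simp [graph, eq_comm]

theorem mem_E {e : Finset ℂ} :
    e ∈ W.graph.E ↔ ∃ g a b, W.adj a b ∧ e = {W.point g a, W.point g b} := by
  simp [graph, eq_comm]

theorem edge_inter (hn : 2 ≤ n) {e f : Finset ℂ} (he : e ∈ W.graph.E) (hf : f ∈ W.graph.E)
    (hef : e ≠ f) {w : ℂ} (hwe : w ∈ edgeSeg e) (hwf : w ∈ edgeSeg f) : w ∈ e ∧ w ∈ f := by
  obtain ⟨g, a, b, hab, rfl⟩ := mem_E.1 he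
  obtain ⟨h, c, d, hcd, rfl⟩ := mem_E.1 hf
  rw [edgeSeg_pair, segment_point] at hwe hwf
  obtain ⟨z, hz, rfl⟩ := hwe
  obtain ⟨z', hz', hzz'⟩ := hwf
  have h1 : dihedralIsometry n (g⁻¹ * h) z' = z := by
    rw [map_mul, LinearIsometryEquiv.coe_mul, Function.comp_apply, hzz',
      ← Function.comp_apply (f := dihedralIsometry n g⁻¹), ← LinearIsometryEquiv.coe_mul, ← map_mul,
      inv_mul_cancel, map_one]
    rfl
  obtain ⟨rfl, h3⟩ := dihedralIsometry_fundamental hn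
    (inSector_of_mem_segment (W.inSector a) (W.inSector b) hz)
    (inSector_of_mem_segment (W.inSector c) (W.inSector d) hz') h1
  have key : (z' = W.pos a ∨ z' = W.pos b) ∧ (z' = W.pos c ∨ z' = W.pos d) := by
    by_cases hgh : g⁻¹ * h = 1
    · obtain rfl := inv_mul_eq_one.1 hgh
      refine W.planar hab hcd (fun hset => hef ?_) z' hz hz'
      have := congrArg (fun s => W.point g '' s) hset
      simp only [Set.image_pair] at this
      rw [← Finset.coe_pair, ← Finset.coe_pair] at this
      exact Finset.coe_injective this
    · have hm : OnMirror n z' := by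
        rcases h3 with h3 | h3 | h3
        · exact (hgh h3).elim
        · exact Or.inl h3.1
        · exact Or.inr h3.1
      exact ⟨endpoint_of_onMirror hab hz hm, endpoint_of_onMirror hcd hz' hm⟩
  constructor
  · rcases key.1 with rfl | rfl <;> simp [point]
  · rw [← hzz']
    rcases key.2 with rfl | rfl <;> simp [point]

theorem mem_of_mem_edgeSeg (hn : 2 ≤ n) {v : ℂ} (hv : v ∈ W.graph.V) {e : Finset ℂ}
    (he : e ∈ W.graph.E) (hve : v ∈ edgeSeg e) : v ∈ e := by
  obtain ⟨g, a, rfl⟩ := mem_V.1 hv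
  obtain ⟨b, hb⟩ := exists_adj (W := W) a
  by_cases hef : e = {W.point g a, W.point g b}
  · simp [hef]
  · refine (edge_inter hn he (mem_E.2 ⟨g, a, b, hb, rfl⟩) hef hve ?_).1
    rw [edgeSeg_pair]
    exact left_mem_segment ..

theorem graph_planar (hn : 2 ≤ n) : W.graph.Planar :=
  ⟨fun _ he _ hf hef _ hw => edge_inter hn he hf hef hw.1 hw.2,
    fun _ hv _ he hve => mem_of_mem_edgeSeg hn hv he hve⟩

theorem mem_E_and_mem_iff (hn : 2 ≤ n) {g : DihedralGroup n} {a : ι} {e : Finset ℂ} :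
    e ∈ W.graph.E ∧ W.point g a ∈ e ↔
      ∃ q ∈ W.nbrs a, e = {W.point g a, dihedralIsometry n g q} := by
  constructor
  · rintro ⟨he, hv⟩
    have main : ∀ h b c, W.adj b c → W.point g a = W.point h b →
        ∃ q ∈ W.nbrs a, ({W.point h b, W.point h c} : Finset ℂ) =
          {W.point g a, dihedralIsometry n g q} := by
      intro h b c hbc hp
      obtain rfl := (point_eq_point hn hp).1
      refine ⟨W.point (g⁻¹ * h) c, ⟨g⁻¹ * h, ?_, c, hbc, rfl⟩, ?_⟩
      · rw [point_mul, ← hp, ← point_mul, inv_mul_cancel, point_one]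
      · rw [← point_mul, mul_inv_cancel_left, hp]
    obtain ⟨h, b, c, hbc, rfl⟩ := mem_E.1 he
    simp only [Finset.mem_insert, Finset.mem_singleton] at hv
    rcases hv with hv | hv
    · exact main h b c hbc hv
    · rw [Finset.pair_comm]
      exact main h c b (W.symm hbc) hv
  · rintro ⟨q, ⟨h, hh, b, hb, rfl⟩, rfl⟩
    refine ⟨mem_E.2 ⟨g * h, a, b, hb, ?_⟩, by simp⟩
    rw [point_mul, point_mul, hh, point]

theorem graph_regular (hn : 2 ≤ n) : W.graph.Regular4 := by
  intro v hv
  obtain ⟨g, a, rfl⟩ := mem_V.1 hv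
  have hset : {e | e ∈ W.graph.E ∧ W.point g a ∈ e} =
      (fun q => ({W.point g a, dihedralIsometry n g q} : Finset ℂ)) '' W.nbrs a := by
    ext e
    rw [Set.mem_ofPred_eq, mem_E_and_mem_iff hn]
    simp only [Set.mem_image, eq_comm]
  rw [degree, hset, Set.ncard_image_of_injective, ncard_nbrs hn]
  intro q r hqr
  have h1 : dihedralIsometry n g q ∈ ({W.point g a, dihedralIsometry n g r} : Finset ℂ) := by
    simp only at hqr
    simp [← hqr]
  have h2 : dihedralIsometry n g r ∈ ({W.point g a, dihedralIsometry n g q} : Finset ℂ) := by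
    simp only at hqr
    simp [hqr]
  simp only [Finset.mem_insert, Finset.mem_singleton] at h1 h2
  apply (dihedralIsometry n g).injective
  rcases h1 with h1 | h1
  · rcases h2 with h2 | h2
    · rw [h1, h2]
    · exact h2.symm
  · exact h1

/-- Two distinct edges at a vertex never point in opposite directions. -/
theorem not_antipodal (hn : 2 ≤ n) {v x y : ℂ} (hx : {v, x} ∈ W.graph.E) (hy : {v, y} ∈ W.graph.E) :
    x + y ≠ 2 * v := by
  have hv : v ∈ W.graph.V := W.graph.edge_sub _ hx (by simp)
  obtain ⟨g, a, rfl⟩ := mem_V.1 hv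
  have main : ∀ x, {W.point g a, x} ∈ W.graph.E → ∃ q ∈ W.nbrs a, x = dihedralIsometry n g q := by
    intro x hx
    obtain ⟨q, hq, heq⟩ := (mem_E_and_mem_iff hn).1 ⟨hx, (by simp : W.point g a ∈ _)⟩
    refine ⟨q, hq, ?_⟩
    have h1 : x ∈ ({W.point g a, dihedralIsometry n g q} : Finset ℂ) := by simp [← heq]
    simp only [Finset.mem_insert, Finset.mem_singleton] at h1
    rcases h1 with h1 | h1
    · obtain ⟨p, r, hpr, hpe, -⟩ := W.graph.edge_pair _ hx
      have hc := Finset.card_pair hpr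
      rw [← hpe, h1, Finset.pair_eq_singleton, Finset.card_singleton] at hc
      norm_num at hc
    · exact h1
  obtain ⟨q, hq, rfl⟩ := main x hx
  obtain ⟨r, hr, rfl⟩ := main y hy
  intro heq
  apply nbrs_bent hn hq hr
  apply (dihedralIsometry n g).injective
  rw [map_add, heq, two_mul, two_mul, map_add, point]

theorem dist_eq_one_of_mem_E {x y : ℂ} (h : {x, y} ∈ W.graph.E) : dist x y = 1 := by
  obtain ⟨p, r, hpr, hpe, hd⟩ := W.graph.edge_pair _ h
  have hp : p ∈ ({x, y} : Finset ℂ) := by simp [hpe]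
  have hr : r ∈ ({x, y} : Finset ℂ) := by simp [hpe]
  simp only [Finset.mem_insert, Finset.mem_singleton] at hp hr
  rcases hp with rfl | rfl <;> rcases hr with rfl | rfl
  · exact (hpr rfl).elim
  · exact hd
  · rwa [dist_comm]
  · exact (hpr rfl).elim

theorem exists_other {e : Finset ℂ} (he : e ∈ W.graph.E) {x : ℂ} (hx : x ∈ e) :
    ∃ y, e = {x, y} := by
  obtain ⟨p, r, -, rfl, -⟩ := W.graph.edge_pair _ he
  simp only [Finset.mem_insert, Finset.mem_singleton] at hx
  rcases hx with rfl | rfl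
  · exact ⟨r, rfl⟩
  · exact ⟨p, Finset.pair_comm _ _⟩

/-- A segment covered by edges consists of a single edge. -/
theorem dist_eq_one_of_sideCovered (hn : 2 ≤ n) {x y : ℂ} (hx : x ∈ W.graph.V) (hxy : x ≠ y)
    (hS : W.graph.SideCovered x y) : dist x y = 1 := by
  obtain ⟨S, hSE, hS⟩ := hS
  have hxS : x ∈ ⋃ e ∈ S, edgeSeg e := hS ▸ left_mem_segment ..
  simp only [Set.mem_iUnion] at hxS
  obtain ⟨e, heS, hxe⟩ := hxS
  obtain ⟨w, rfl⟩ := exists_other (hSE heS) (mem_of_mem_edgeSeg hn hx (hSE heS) hxe)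
  have hxw := dist_eq_one_of_mem_E (hSE heS)
  have hsub : ∀ f ∈ S, edgeSeg f ⊆ segment ℝ x y := by
    intro f hf
    rw [hS]
    exact Set.subset_biUnion_of_mem (u := fun f => edgeSeg f) hf
  have hwV : w ∈ W.graph.V := W.graph.edge_sub _ (hSE heS) (by simp)
  have hw : w ∈ segment ℝ x y := hsub _ heS (by rw [edgeSeg_pair]; exact right_mem_segment ..)
  by_contra hne
  rw [segment_eq_image'] at hw
  obtain ⟨t, ⟨ht0, ht1⟩, rfl⟩ := hw
  have ht0' : 0 < t := by
    rcases ht0.eq_or_lt with rfl | h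
    · simp at hxw
    · exact h
  have ht1' : t < 1 := by
    rcases ht1.eq_or_lt with rfl | h
    · simp only [one_smul, add_sub_cancel] at hxw
      exact (hne hxw).elim
    · exact h
  have hd : y - x ≠ 0 := sub_ne_zero.2 hxy.symm
  have htd : t * ‖y - x‖ = 1 := by
    rw [dist_self_add_right, norm_smul, Real.norm_of_nonneg ht0] at hxw
    exact hxw
  set C : Set ℂ := ⋃ f ∈ S.filter (fun f => x + t • (y - x) ∉ f), edgeSeg f with hC
  have hCcl : IsClosed C := by
    refine isClosed_biUnion_finset fun f _ => ?_
    exact (f.finite_toSet.isCompact_convexHull ℝ).isClosed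
  have hwC : x + t • (y - x) ∉ C := by
    simp only [hC, Set.mem_iUnion, Finset.mem_filter, not_exists]
    rintro f ⟨hf, hwf⟩ hwf'
    exact hwf (mem_of_mem_edgeSeg hn hwV (hSE hf) hwf')
  have hcont : Continuous fun s : ℝ => x + s • (y - x) := by fun_prop
  have hev : ∀ᶠ s in nhdsWithin t (Set.Ioi t), x + s • (y - x) ∉ C ∧ s < 1 := by
    refine Filter.Eventually.filter_mono nhdsWithin_le_nhds (Filter.Eventually.and ?_ ?_)
    · exact hcont.continuousAt.eventually (hCcl.isOpen_compl.eventually_mem hwC)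
    · exact eventually_lt_nhds ht1'
  obtain ⟨s, ⟨hsC, hs1⟩, hst⟩ := (hev.and self_mem_nhdsWithin).exists
  have hsS : x + s • (y - x) ∈ ⋃ e ∈ S, edgeSeg e := by
    rw [← hS, segment_eq_image']
    exact ⟨s, ⟨by linarith, hs1.le⟩, rfl⟩
  simp only [Set.mem_iUnion] at hsS
  obtain ⟨f, hfS, hsf⟩ := hsS
  have hwf : x + t • (y - x) ∈ f := by
    by_contra hwf
    exact hsC (Set.mem_biUnion (Finset.mem_filter.2 ⟨hfS, hwf⟩) hsf)
  obtain ⟨u, rfl⟩ := exists_other (hSE hfS) hwf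
  have hu : u ∈ segment ℝ x y := hsub _ hfS (by rw [edgeSeg_pair]; exact right_mem_segment ..)
  have hwu := dist_eq_one_of_mem_E (hSE hfS)
  rw [segment_eq_image'] at hu
  obtain ⟨r, ⟨hr0, hr1⟩, rfl⟩ := hu
  rw [edgeSeg_pair, segment_eq_image'] at hsf
  obtain ⟨q, ⟨hq0, hq1⟩, hq⟩ := hsf
  have hq' : (t + q * (r - t) - s) • (y - x) = 0 := by
    have : x + t • (y - x) + q • ((x + r • (y - x)) - (x + t • (y - x))) - (x + s • (y - x)) = 0 :=
      sub_eq_zero.2 hq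
    rw [← this]
    module
  have hq2 := (smul_eq_zero.1 hq').resolve_right hd
  have hrt : t < r := by
    by_contra! hle
    nlinarith
  rw [dist_add_left, dist_eq_norm, ← sub_smul, norm_smul, Real.norm_eq_abs, abs_sub_comm,
    abs_of_pos (sub_pos.2 hrt), ← htd] at hwu
  have hr2 : r = 2 * t := by
    have := mul_right_cancel₀ (norm_ne_zero_iff.2 hd) hwu
    linarith
  apply not_antipodal hn (by rw [Finset.pair_comm]; exact hSE heS) (hSE hfS)
  rw [hr2, two_mul, two_mul]
  module

theorem graph_noAdditionalTriangles (hn : 2 ≤ n) : W.graph.NoAdditionalTriangles :=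
  fun _ hx _ _ _ _ hxy _ _ _ _ hS _ _ => dist_eq_one_of_sideCovered hn hx hxy hS

theorem isUnitTriangle_image {g : DihedralGroup n} {a b c : ι} (hab : W.adj a b) (hac : W.adj a c)
    (hbc : W.adj b c) : W.graph.IsUnitTriangle {W.point g a, W.point g b, W.point g c} := by
  have h1 := (point_injective (W := W) g).ne (ne_of_adj hab)
  have h2 := (point_injective (W := W) g).ne (ne_of_adj hac)
  have h3 := (point_injective (W := W) g).ne (ne_of_adj hbc)
  refine ⟨?_, Finset.card_eq_three.2 ⟨_, _, _, h1, h2, h3, rfl⟩, ?_⟩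
  · intro v hv
    simp only [Finset.mem_insert, Finset.mem_singleton] at hv
    rcases hv with rfl | rfl | rfl <;> exact mem_V.2 ⟨g, _, rfl⟩
  · intro x hx y hy hxy
    simp only [Finset.mem_insert, Finset.mem_singleton] at hx hy
    rcases hx with rfl | rfl | rfl <;> rcases hy with rfl | rfl | rfl <;>
      first
        | exact (hxy rfl).elim
        | exact mem_E.2 ⟨g, _, _, by assumption, rfl⟩
        | exact mem_E.2 ⟨g, _, _, W.symm (by assumption), rfl⟩

theorem graph_onlyUnitTriangles : W.graph.OnlyUnitTriangles := by
  intro e he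
  obtain ⟨g, a, b, hab, rfl⟩ := mem_E.1 he
  obtain ⟨c, hac, hbc⟩ := W.exists_triangle hab
  refine ⟨_, isUnitTriangle_image (g := g) hab hac hbc, ?_⟩
  intro v hv
  simp only [Finset.mem_insert, Finset.mem_singleton] at hv ⊢
  tauto

theorem exists_of_isUnitTriangle (hn : 2 ≤ n) {t : Finset ℂ} (ht : W.graph.IsUnitTriangle t) :
    ∃ g a b c, W.adj a b ∧ W.adj a c ∧ W.adj b c ∧
      t = {W.point g a, W.point g b, W.point g c} := by
  obtain ⟨-, hcard, hE⟩ := ht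
  obtain ⟨x, y, z, hxy, hxz, hyz, rfl⟩ := Finset.card_eq_three.1 hcard
  have hExy := hE x (by simp) y (by simp) hxy
  have hExz := hE x (by simp) z (by simp) hxz
  have hEyz := hE y (by simp) z (by simp) hyz
  obtain ⟨g, a, b, hab, hpair⟩ := mem_E.1 hExy
  have third : ∀ a, W.point g a ≠ z → {W.point g a, z} ∈ W.graph.E →
      ∃ q ∈ W.nbrs a, z = dihedralIsometry n g q := by
    intro a hne hE
    obtain ⟨q, hq, heq⟩ := (mem_E_and_mem_iff hn).1 ⟨hE, (by simp : W.point g a ∈ _)⟩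
    refine ⟨q, hq, ?_⟩
    have : z ∈ ({W.point g a, dihedralIsometry n g q} : Finset ℂ) := by simp [← heq]
    simp only [Finset.mem_insert, Finset.mem_singleton] at this
    exact this.resolve_left hne.symm
  have main : ∀ a b, W.adj a b → ¬ OnMirror n (W.pos a) → W.point g a ≠ z → W.point g b ≠ z →
      {W.point g a, z} ∈ W.graph.E → {W.point g b, z} ∈ W.graph.E →
      ∃ c, W.adj a c ∧ W.adj b c ∧ z = W.point g c := by
    intro a b hab ha hza hzb hEa hEb
    obtain ⟨_, ⟨h, hh, c, hc, rfl⟩, hz⟩ := third a hza hEa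
    obtain ⟨_, ⟨h', hh', c', hc', rfl⟩, hz'⟩ := third b hzb hEb
    obtain rfl := stabilizer_interior hn ha hh
    rw [← point_mul, mul_one] at hz
    rw [← point_mul, hz] at hz'
    obtain rfl := (point_eq_point hn hz').1
    exact ⟨c, hc, hc', hz⟩
  have hmem : ∀ v, v ∈ ({x, y} : Finset ℂ) → v ≠ z ∧ {v, z} ∈ W.graph.E := by
    intro v hv
    simp only [Finset.mem_insert, Finset.mem_singleton] at hv
    rcases hv with rfl | rfl
    · exact ⟨hxz, hExz⟩
    · exact ⟨hyz, hEyz⟩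
  obtain ⟨hza, hEa⟩ := hmem (W.point g a) (by simp [hpair])
  obtain ⟨hzb, hEb⟩ := hmem (W.point g b) (by simp [hpair])
  have hfin : ∀ c, z = W.point g c →
      ({x, y, z} : Finset ℂ) = {W.point g a, W.point g b, W.point g c} := by
    intro c hc
    have h1 : ({x, y, z} : Finset ℂ) = {x, y} ∪ {z} := by
      ext v
      simp
    rw [h1, hpair, hc]
    ext v
    simp
  by_cases ha : OnMirror n (W.pos a)
  · obtain ⟨c, hbc, hac, hz⟩ := main b a (W.symm hab) (W.not_mirror hab ha) hzb hza hEb hEa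
    exact ⟨g, a, b, c, hab, hac, hbc, hfin c hz⟩
  · obtain ⟨c, hac, hbc, hz⟩ := main a b hab ha hza hzb hEa hEb
    exact ⟨g, a, b, c, hab, hac, hbc, hfin c hz⟩

theorem graph_triangleCount (hn : 2 ≤ n) (T : Finset (Finset ι))
    (hT : ∀ t, t ∈ T ↔ ∃ a b c, W.adj a b ∧ W.adj a c ∧ W.adj b c ∧ t = {a, b, c}) :
    W.graph.triangleCount = 2 * n * T.card := by
  have hset : {t | W.graph.IsUnitTriangle t} =
      (fun x : DihedralGroup n × Finset ι => x.2.image (W.point x.1)) '' {x | x.2 ∈ T} := by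
    ext t
    simp only [Set.mem_ofPred_eq, Set.mem_image, Prod.exists, hT]
    constructor
    · intro ht
      obtain ⟨g, a, b, c, hab, hac, hbc, rfl⟩ := exists_of_isUnitTriangle hn ht
      exact ⟨g, {a, b, c}, ⟨a, b, c, hab, hac, hbc, rfl⟩, by simp [Finset.image_insert]⟩
    · rintro ⟨g, _, ⟨a, b, c, hab, hac, hbc, rfl⟩, rfl⟩
      simpa [Finset.image_insert] using isUnitTriangle_image (g := g) hab hac hbc
  rw [triangleCount, hset, Set.InjOn.ncard_image]
  · have : {x : DihedralGroup n × Finset ι | x.2 ∈ T} =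
        ((Finset.univ ×ˢ T : Finset (DihedralGroup n × Finset ι)) : Set _) := by
      ext x
      simp
    rw [this, Set.ncard_coe_finset, Finset.card_product, Finset.card_univ, DihedralGroup.card]
  · rintro ⟨g, s⟩ hs ⟨h, t⟩ - hst
    simp only [Set.mem_ofPred_eq, hT] at hs hst
    obtain ⟨a, b, c, hab, hac, hbc, hs'⟩ := hs
    have hinterior : ∃ d ∈ s, ¬ OnMirror n (W.pos d) := by
      by_cases ha : OnMirror n (W.pos a)
      · exact ⟨b, by simp [hs'], W.not_mirror hab ha⟩
      · exact ⟨a, by simp [hs'], ha⟩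
    obtain ⟨d, hds, hd⟩ := hinterior
    have hmem : W.point g d ∈ t.image (W.point h) := hst ▸ Finset.mem_image_of_mem _ hds
    obtain ⟨d', -, hd'⟩ := Finset.mem_image.1 hmem
    obtain rfl := eq_of_point_eq_point hn hd'.symm hd
    rw [Finset.image_injective (point_injective g) hst]

theorem image_V (g : DihedralGroup n) :
    dihedralIsometry n g '' (W.graph.V : Set ℂ) = W.graph.V := by
  ext v
  simp only [Set.mem_image, Finset.mem_coe, mem_V]
  constructor
  · rintro ⟨_, ⟨h, a, rfl⟩, rfl⟩
    exact ⟨g * h, a, (point_mul g h a).symm⟩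
  · rintro ⟨h, a, rfl⟩
    exact ⟨_, ⟨g⁻¹ * h, a, rfl⟩, by rw [← point_mul, mul_inv_cancel_left]⟩

theorem image_E (g : DihedralGroup n) :
    Finset.image (dihedralIsometry n g) '' (W.graph.E : Set (Finset ℂ)) = W.graph.E := by
  ext e
  simp only [Set.mem_image, Finset.mem_coe, mem_E]
  constructor
  · rintro ⟨_, ⟨h, a, b, hab, rfl⟩, rfl⟩
    exact ⟨g * h, a, b, hab, by simp [Finset.image_insert, point_mul]⟩
  · rintro ⟨h, a, b, hab, rfl⟩
    refine ⟨_, ⟨g⁻¹ * h, a, b, hab, rfl⟩, ?_⟩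
    simp only [Finset.image_insert, Finset.image_singleton, ← point_mul, mul_inv_cancel_left]

theorem graph_rotInvariant {m : ℕ} (hm : m < n) {θ : ℝ} (hθ : θ = 2 * (Real.pi / n) * m) :
    W.graph.RotInvariant 0 θ := by
  have hrot : rot 0 θ = dihedralIsometry n (.r (m : ZMod n)) := by
    ext z
    rw [dihedralIsometry_r, rot, ZMod.val_natCast_of_lt hm, hθ]
    simp
  rw [RotInvariant, hrot]
  exact ⟨image_V _, image_E _⟩

end RingWedge

/-- A simplified Newton iteration: a map close to the identity on a ball has a zero there. -/
theorem exists_zero_of_near_identity {ι : Type} [Fintype ι] (F : (ι → ℝ) → ι → ℝ) {r : ℝ}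
    (hr : 0 < r) (h0 : ∀ k, |F 0 k| ≤ r / 2)
    (hF : ∀ u v : ι → ℝ, ∀ H, (∀ l, |u l| ≤ r) → (∀ l, |v l| ≤ r) → (∀ l, |u l - v l| ≤ H) →
      ∀ k, |(u k - v k) - (F u k - F v k)| ≤ 1 / 2 * H) :
    ∃ u, (∀ l, |u l| ≤ r) ∧ ∀ k, F u k = 0 := by
  set s : Set (ι → ℝ) := Metric.closedBall 0 r with hs
  have hmem : ∀ u, u ∈ s ↔ ∀ l, |u l| ≤ r := by
    intro u
    rw [hs, mem_closedBall_zero_iff, pi_norm_le_iff_of_nonneg hr.le]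
    simp only [Real.norm_eq_abs]
  have hlip : ∀ u ∈ s, ∀ v ∈ s, ‖(u - F u) - (v - F v)‖ ≤ 1 / 2 * ‖u - v‖ := by
    intro u hu v hv
    rw [pi_norm_le_iff_of_nonneg (by positivity)]
    intro k
    have h := hF u v ‖u - v‖ ((hmem u).1 hu) ((hmem v).1 hv)
      (fun l => norm_le_pi_norm (u - v) l) k
    rw [Real.norm_eq_abs]
    convert h using 2
    simp only [Pi.sub_apply]
    ring
  have h0s : (0 : ι → ℝ) ∈ s := by simp [hs, hr.le]
  have hmaps : Set.MapsTo (fun u => u - F u) s s := by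
    intro u hu
    have h1 := hlip u hu 0 h0s
    have h2 : ‖F 0‖ ≤ r / 2 := by
      rw [pi_norm_le_iff_of_nonneg (by positivity)]
      exact h0
    have h3 : ‖u‖ ≤ r := by simpa [hs] using hu
    rw [hs, mem_closedBall_zero_iff]
    calc ‖u - F u‖ = ‖((u - F u) - (0 - F 0)) + -F 0‖ := by congr 1; abel
      _ ≤ ‖(u - F u) - (0 - F 0)‖ + ‖-F 0‖ := norm_add_le _ _
      _ ≤ 1 / 2 * ‖u - 0‖ + r / 2 := by rw [norm_neg]; gcongr
      _ ≤ r := by rw [sub_zero]; linarith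
  have hcontr : ContractingWith (1 / 2) (hmaps.restrict _ s s) := by
    refine ⟨by rw [← NNReal.coe_lt_coe]; norm_num, LipschitzWith.of_dist_le_mul ?_⟩
    rintro ⟨u, hu⟩ ⟨v, hv⟩
    rw [Subtype.dist_eq, Subtype.dist_eq, dist_eq_norm, dist_eq_norm]
    simpa using hlip u hu v hv
  obtain ⟨u, hu, hfix, -⟩ := hcontr.exists_fixedPoint' (x := 0)
    (Metric.isClosed_closedBall.isComplete) hmaps h0s (edist_ne_top _ _)
  refine ⟨u, (hmem u).1 hu, fun k => ?_⟩
  have := congrFun hfix k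
  simpa using this

theorem abs_sum_mul_le {ι : Type} [Fintype ι] {a h : ι → ℝ} {M H : ℝ} (ha : ∑ l, |a l| ≤ M)
    (hH : 0 ≤ H) (hh : ∀ l, |h l| ≤ H) : |∑ l, a l * h l| ≤ M * H :=
  calc |∑ l, a l * h l| ≤ ∑ l, |a l * h l| := Finset.abs_sum_le_sum_abs _ _
    _ ≤ ∑ l, |a l| * H := by
      gcongr with l
      rw [abs_mul]
      exact mul_le_mul_of_nonneg_left (hh l) (abs_nonneg _)
    _ = (∑ l, |a l|) * H := by rw [Finset.sum_mul]
    _ ≤ M * H := by gcongr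

theorem sum_pi_single_sub_mul {ι : Type} [Fintype ι] [DecidableEq ι] (m h : ι → ℝ) (k : ι) :
    ∑ l, ((if l = k then 1 else 0) - m l) * h l = h k - ∑ l, m l * h l := by
  simp only [sub_mul, Finset.sum_sub_distrib, ite_mul, one_mul, zero_mul, Finset.sum_ite_eq',
    Finset.mem_univ, if_true]

theorem abs_sub_linear_le {ι : Type} [Fintype ι] [DecidableEq ι] {m : ι → ℝ} {k : ι} {σ : ℝ}
    (hσ : ∑ l, |(if l = k then 1 else 0) - m l| ≤ σ) {u v : ι → ℝ} {H : ℝ}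
    (hH : ∀ l, |u l - v l| ≤ H) {α : ℝ} :
    |(u k - v k) - ((α + ∑ l, m l * u l) - (α + ∑ l, m l * v l))| ≤ σ * H := by
  have h := abs_sum_mul_le hσ ((abs_nonneg _).trans (hH k)) hH
  rw [sum_pi_single_sub_mul (h := fun l => u l - v l)] at h
  convert h using 2
  simp only [mul_sub, Finset.sum_sub_distrib]
  ring

theorem abs_sub_quadratic_le {ι : Type} [Fintype ι] [DecidableEq ι] {a b : ι → ℝ} {k : ι}
    {σ M r α β γ : ℝ} (hσ : ∑ l, |(if l = k then 1 else 0) - 2 * (α * a l + β * b l)| ≤ σ)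
    (ha : ∑ l, |a l| ≤ M) (hb : ∑ l, |b l| ≤ M) {u v : ι → ℝ} {H : ℝ}
    (hu : ∀ l, |u l| ≤ r) (hv : ∀ l, |v l| ≤ r) (hH : ∀ l, |u l - v l| ≤ H) :
    |(u k - v k) - (((α + ∑ l, a l * u l) ^ 2 + (β + ∑ l, b l * u l) ^ 2 - γ) -
      ((α + ∑ l, a l * v l) ^ 2 + (β + ∑ l, b l * v l) ^ 2 - γ))| ≤ (σ + 4 * r * M ^ 2) * H := by
  have hH0 := (abs_nonneg _).trans (hH k)
  have hr0 : 0 ≤ r := (abs_nonneg _).trans (hu k)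
  have hM0 : 0 ≤ M := (Finset.sum_nonneg fun _ _ => abs_nonneg _).trans ha
  have h1 := abs_sub_linear_le hσ hH (α := 0)
  have hsum : ∀ l, |u l + v l| ≤ 2 * r := fun l =>
    (abs_add_le _ _).trans (by linarith [hu l, hv l])
  have key : ∀ c : ι → ℝ, ∑ l, |c l| ≤ M →
      |(∑ l, c l * (u l - v l)) * ∑ l, c l * (u l + v l)| ≤ 2 * r * M ^ 2 * H := by
    intro c hc
    rw [abs_mul]
    calc _ ≤ (M * H) * (M * (2 * r)) := by
          gcongr
          · exact abs_sum_mul_le hc hH0 hH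
          · exact abs_sum_mul_le hc (by positivity) hsum
      _ = 2 * r * M ^ 2 * H := by ring
  have h2 := key a ha
  have h3 := key b hb
  have h4 : (u k - v k) - (((α + ∑ l, a l * u l) ^ 2 + (β + ∑ l, b l * u l) ^ 2 - γ) -
      ((α + ∑ l, a l * v l) ^ 2 + (β + ∑ l, b l * v l) ^ 2 - γ)) =
      ((u k - v k) - ((0 + ∑ l, 2 * (α * a l + β * b l) * u l) -
        (0 + ∑ l, 2 * (α * a l + β * b l) * v l))) -
      (∑ l, a l * (u l - v l)) * (∑ l, a l * (u l + v l)) -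
      (∑ l, b l * (u l - v l)) * ∑ l, b l * (u l + v l) := by
    have e : ∀ w : ι → ℝ, ∑ l, 2 * (α * a l + β * b l) * w l =
        2 * α * ∑ l, a l * w l + 2 * β * ∑ l, b l * w l := by
      intro w
      rw [Finset.mul_sum, Finset.mul_sum, ← Finset.sum_add_distrib]
      exact Finset.sum_congr rfl fun l _ => by ring
    rw [e u, e v]
    simp only [mul_sub, mul_add, Finset.sum_sub_distrib, Finset.sum_add_distrib]
    ring
  rw [h4]
  calc _ ≤ σ * H + 2 * r * M ^ 2 * H + 2 * r * M ^ 2 * H :=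
        (abs_sub _ _).trans (add_le_add ((abs_sub _ _).trans (add_le_add h1 h2)) h3)
    _ = _ := by ring

/-- The abscissas of the approximate wedge vertices, in units of `10⁻¹²`. -/
def approxX : List ℕ :=
  [175096173842401, 176228561624833, 178367476632996, 180007199388024, 181090087850177,
    181435153416934, 183402920980246, 174636510497860, 176621310257810, 177368815386393,
    181534091966662, 181658776655024, 183324901879794, 174665430218861, 175041473473388,
    175630827663867, 175655912812803, 175662367733617, 176245267003283, 176650229978810,
    176659305248374, 176904021847940, 177392544852038, 177614796651417, 177903214042921,
    178072704844291, 178841454992035, 179549822191328, 179806917524105, 180548643619100,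
    180630763141717, 180709715875953, 181435153416934, 181547465046873, 181612111067114,
    181772242060635, 182419037198590, 182419037198590, 182500525789084, 183065832336545,
    183402920980246]

/-- The ordinates of the approximate wedge vertices, in units of `10⁻¹²`. -/
def approxY : List ℕ :=
  [0, 0, 0, 0, 0, 0, 0, 2743409532245, 2774589258440, 2786332007361, 2851765400654,
    2853724104258, 2879897690816, 902474338017, 1829076448269, 2636951214656, 1040112381801,
    824272089513, 1847987148188, 933654064212, 902474338017, 1900912916414, 222503983061,
    1197493284373, 1941099450072, 955567680797, 1595116905129, 889272792760, 1855658838740,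
    840736667830, 1288844584912, 2285722945474, 1882945826398, 889272792760, 1854813536237,
    941472913199, 1704136698571, 178809127827, 2313855235635, 941472913199, 1882945826398]

/-- The edges of the wedge. The vertices `0` to `6` lie on the lower mirror and the vertices `7` to
`12` on the upper mirror. -/
def wedgeEdges : List (ℕ × ℕ) :=
  [(7, 15), (7, 14), (14, 15), (13, 14), (13, 16), (14, 16), (13, 17), (0, 13), (0, 17),
    (15, 18), (8, 18), (8, 15), (17, 20), (1, 17), (1, 20), (16, 18), (16, 19), (18, 19),
    (19, 23), (21, 23), (19, 21), (20, 23), (20, 22), (22, 23), (9, 21), (21, 24), (9, 24),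
    (2, 22), (2, 25), (22, 25), (25, 26), (24, 26), (24, 25), (27, 28), (26, 28), (26, 27),
    (3, 27), (3, 29), (27, 29), (28, 31), (28, 30), (30, 31), (29, 33), (4, 29), (4, 33),
    (32, 33), (30, 32), (30, 33), (31, 34), (10, 34), (10, 31), (32, 36), (32, 35), (35, 36),
    (5, 35), (5, 37), (35, 37), (34, 38), (11, 38), (11, 34), (36, 39), (39, 40), (36, 40),
    (6, 39), (37, 39), (6, 37), (12, 38), (38, 40), (12, 40)]

/-- The rows for the abscissas of an approximate inverse of the Jacobian of the distance and mirror
equations, in units of `10⁻³`. Each row is packed in base `10⁶`, the entries shifted by `500000`. -/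
def newtonX : List ℕ :=
  [
    501748500809499000411515520316502948498288501821495680504587534540547719481021499159499959499937500333499475499028500445499006499501499611499971499927500520499646501034500547501013499758500036500481499867499425500000499084498650498859501249500126499373499888499974501211501434501081499220500529521022500867498958502010519442494122524452491302526619501072494373542717522047502693455453493604465018491125515599511867530063504581488358497173494759494272539780497582461102503556503629498310500665,
    501704500789499025409068519304506445498331501776495788504473535510552770475010499180499960499939500325499488499052500434499031499513499621499972499929500508499654501009500533500988499764500035500469499870499440500000499106498683498888501218500123499388499891499975501181501398501054499239500516521621500845498984502126519988493957525129491022527355501032494250546944522623502811451188494744460564491360516774513644533516504353488938498053493785491831544795496140457664502113502834496307501453,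
    501977500915498869410400520201503974498063502060495113505190535171547868480191499049499953499929500377499406498900500504498876499435499560499967499918500589499599501170500619501146499726500041500544499849499350500000498963498472498709501413500143499290499874499970501370501622501223499117500598521247500981498821501897519669494566524760491282526954500945494821544412522401502628453851493875463444491116515648511904531996504555488424497400495074493525541555497149459785503174503433497723500896,
    499720500574499404412700519618504319500250499759499948502097533822548072479710500134499979500010499951500073500142499960500140500075499724499979500008499927500047499863499929499861500056500021500287499969499729500025500106499984499986500244500032499726499985500215500040501141501126499689500238520628501145499250502262519037494244524125491672526263500710494660544135521966502377454365494156463717491346515714511955531584504424488758497569494954493367541239497034460267502922503256497525500974,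
    503545499617500147407726520735504565496596503550494930503468535749550811478554498295499995499872500663498967498066500812498038499002500184500014499864501026499309502017501061501988499459499995499929499881499879499928498257497930499175501255500106499805499867500311500916501084501190499671500144521803501210499207502391520122493916525499491197527759500750494356546650523217502513451765493823461650490853516610512636533383504676488118497430494667492989543589496865458004503089503442497384501029,
    501375495585504643410077520207504449499781500116496012504294534838549516479100499339500165499951500043499476499875500123499352500122502124500159499971500402499434500169499961500526500229499833497767500274499309500392499225498753498947501292499724499588500146500107501134501342501160499680500393521248501180499227502330519609494071524850491421527052500731494500545461522626502449452993493980462627491086516186512314532532504556488421497496494802493168542478496945459073503010503354497451501003,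
    500832495995504243410811520042504413500290500128496026504276534553549112479271499600500152499970500487499665500062500015499643500181501927500144499990500444499975500073499873500535500217499847497959500266499316500382499226498758498951501283499734499587500150500102501129501337501151499682500395521074501170499234502311519449494119524647491491526831500725494545545090522441502429453377494029462932491159516054512214532267504519488515497516494845493224542131496970459408502986503327497471500995,
    501723500797499014410187518826505788498312501796495740504523535066549689478530499171499959499938500329499482499041500439499020499508499616499971499928500513499651501020500539500999499761500035500474499868499433500000499096498668498875501231500125499381499890499974501194501414501066499230500521521347500855498973502073519738494032524819491149527018501050494307545038522359502758453112494234462571491735516243512357531960504245489212497525494661492982542010496390459747502689503243496745500777,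
    501711500792499021410429518631505752498324501783495770504492534973549739478576499177499959499938500326499485499048500436499027499511499619499971499929500510499653501013500535500992499763500035500471499869499437500000499103498678498883501223500124499386499891499974501186501404501058499236500518521291500849498980502073519686494048524753491170526946501041494324545162522297502754452994494356462391491734516259512370532085504736489245497626494672492997542136496341459596502737503296496704501297,
    501417500656499189410135520583504355498612501476496498503719534407549830479115499319499966499949500270499574499212500361499194499595499685499976499941500422499713500839500443500821499803500029500390499892499534500000499257498905499075501012500102499491499910499979500982501163500876499367500429520972500703499155502212519367494144524323491209527522500824494517545922522966502561452433493828462231490930516289512392532942504641488205497413494806493173542930496963458572503128503446497504500982,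
    502263499752499418410310520155504438497827502266494967505307534747549388479154498911499997499919500423499341498765500518498747499363500119500009499913500655499559501287500677501269499654500597499953499924499432499954498887498427498671501367500176499339500454499887501401501659501157499681500676521193501176499229502324519559494086524785491444526982500729494514545344522567502442453115493996462724491109516145512282532448504545488451497502494816493186542368496953459180503002503345497457501001,
    500202495401505445410840520036504411499420501016496088504217534542549096479277499903499552499993500113499754499671500560499586499859502524499589499928500226499802500577500331500492500250499804497381500286499310500407499245498777498967501278499708499601500132500115501114501318501150499682500379521068501170499234502310519443494121524639491494526822500725494546545076522434502428453393494031462944491162516049512210532256504518488519497517494847493226542117496971459421502985503326497472500995,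
    500665507351493245410547520102504426498537501709495467504821534656549258479209499353499799500552500285499525499169500537499121499584496464499735500558500464499667500971500523500923499920500243503249500086499377500156499047498583498803501328499967499456500311499989501273501507501154499681500543521137501173499231502318519507494102524720491466526910500727494529545224522508502436453239494012462822491133516102512250532363504533488481497509494830493204542256496961459287502994503337497464500998,
    501724500798499014410175519762504863498311501796495739504525535071549687478527499171499959499938500329499482499041500439499020499508499616499971499928500513499650501020500539500999499761500036500474499868499433500000499096498668498875501232500125499381499890499974501195501414501066499230500522521350500855498972502073519741494031524823491148527022501050494306545031522363502758453118494228462580491253516242512357531953504456488676497655494660492981542004496793459220502766503194497213501096,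
    501678500777499040411091518614505136498356501749495852504405534718549875478702499193499960499940500320499495499066500427499046499521499626499972499930500500499660500993500525500973499767500035500462499872499448500000499120498703498905501199500121499398499893499975501163501377501038499251500508521137500832498999502071519542494091524570491227526747501018494374545502522124502743452670494689461896491730516304512404532428504197489334497904494703493038542480496206459182502867502915497057501158,
    501718500795499017410293518801505712498317501790495753504509535026549711478550499174499959499938500328499483499044500438499023499509499618499971499928500512499652501017500537500996499762500035500473499869499435500000499099498673498879501228500124499383499890499974501191501410501063499233500520521322500852498976502073519715494039524790491158526987501046494314545092522332502756453061494287462492491735516250512363532014504239489226497569494666492988542065496369459681502710503266496727501288,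
    501717500795499017410311519592504903498318501789495756504507535018549715478553499174499959499938500327499484499045500437499024499510499618499971499928500511499652501016500537500995499762500035500473499869499435500000499100498673498879501227500124499384499890499974501190501409501062499233500519521318500852498976502073519711494040524785491160526981501046494316545101522327502756453052494297462478491324516251512364532024504418488773497692494666492989542075496785459670502713503153497190501106,
    501726500799499012410291519810504697498309501798495734504530535025549516478744499170499959499938500329499481499040500440499019499507499616499971499928500514499650501022500540501001499761500036500475499868499432500000499095498666498873501233500125499380499890499974501196501416501068499229500522521321500856498971502068519715494039524791491162526987501052494312544831522335502752453321494174462791491242516187512314531790504467488648497613494714493051542287496861459383502835503232497309501059,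
    501757500813498995409513519779505479498279501831495657504611535326549551478401499155499958499937500335499472499022500447499001499498499609499971499927500523499644501040500550501019499756500036500484499866499422500000499079498643498853501255500127499369499888499974501218501441501087499215500531521503500871498953502075519884493988525006491092527221501073494257544691522535502768453442493895463074491739516198512323531610504460488666497777494629492940541659496528460170502556503094496861501235,
    501712500792499020410417519567504828498323501784495769504493534978549737478573499177499959499938500326499485499048500436499027499511499619499971499929500510499653501013500536500992499763500035500471499869499437500000499102498677498883501223500124499386499891499974501186501405501059499236500518521294500849498979502073519688494047524756491169526950501042494324545155522300502754453000494288462927491339516259512369532078504412488787497681494671492996542129496819459604502734503160497234501089,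
    501728500800499011410408519858504531498307501801495729504536534979549208479098499169499959499938500329499480499039500440499018499506499615499971499928500515499650501023500541501002499760500036500476499868499432500000499094498665498872501235500125499380499890499974501198501418501069499228500523521293500857498970502062519689494047524758491175526952501054494317544630522308502746453523494120463002491231516086512237532147504478488621497571494802493167542049496929459546502903503269497404501022,
    501251500579499284410707520039504475498775501303496908503283534935549323479129499398499970499955500238499624499304500319499289499643499722499979499948500372499746500740500391500725499826500026500344499904499589500000499344499034499184500894500090499551499920499981500867501026500774499441500378521312500620499254502369519664494054524676491000526862500696494503545222522467502404453271494044462829491157516123512266532333504519488517497529494810493177542247496943459320502963503316497435501009,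
    502055500951498824410204520232504069497987502141494920505394535008548249479957499012499951499926500392499382498857500523498832499413499543499966499914500612499583501216500643501191499715500042500566499843499324500000498922498412498659501469500148499262499869499969501424501686501271499082500622521279501019498775501852519705494042524815491295527013500907494753544676522477502598453621493886463236491097515772511999532145504562488406497414495016493448541790497106459592503148503423497668500917,
    501586500734499092410496519696504732498446501653496080504163534966549624478725499237499962499943500302499523499118500404499098499547499647499974499934500472499678500939500496500920499780500033500437499879499478500000499168498774498965501133500115499431499899499976501099501301500981499292500480521299500787499054502153519682494049524734491123526926500948494372545174522235502811453480494222462901491289516222512341532148504441488714497639494709493045542161496853459526502797503203497289501067,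
    501258500582499280410681520064504470498767501311496890503303534911549346479128499395499970499955500240499622499300500320499285499641499720499979499948500375499745500745500394500730499825500026500346499904499586500000499340499028499179500899500091499548499920499981500872501032500778499438500381521297500624499250502361519651494059524683491498526870500702494503545254522490502411453233494035462802491146516131512272532360504524488503497524494809493177542278496944459286502971503322497439501008,
    502312501070498677409559520337504381497736502409494286506068534470549501479187498888499945499917500441499305498714500589498686499340499485499961499904500688499531501368500723501340499679500048500636499823499240500000498788498214498491501652500167499170499852499965501602501897501430498968500699521386501147498622502257519402494134524993491337527208500779494530545543522727502501452863493920462551491034516182512310532634504586488346497460494824493196542565496967458953503063503392497490500988,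
    501628500753499068410287520160504439498405501697495976504273534756549401479149499217499961499941500310499510499094500415499074499535499638499973499932500485499670500964500509500944499774500034500448499876499465500000499146498742498937501163500118499416499896499976501128501336501007499273500493521198501177499229502325519564494085524792491441526989500729494513545355522573502443453103493994462714491107516149512285532457504546488448497502494815493184542379496952459169503003503346497456501001,
    501743500068499797410069520209504449498317501764496473503643534841549520479098499162499988499937500327499488499044500411499028499508499967499998499931500508499657501002500528500986499740500007500098499922499808499974499128498897499069500779500071499768499923499752500962501139501160499680500188521250501180499227502330519611494071524852491421527054500731494499545465522628502449452990493980462624491085516188512315532535504557488420497495494802493167542482496944459070503010503354497450501003,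
    501586501007498799410367520142504435498438501672495792504506534725549356479167499237499952499943500304499519499113500416499091499545499516499964499932500476499675500950500502500928499787500043500577499858499338500010499153498685498889501305500135499286499886500058501190501409501156499681500454521179501176499230502323519546494090524770491449526964500729494518545315522553502441453145494000462747491115516134512274532428504542488458497504494819493190542341496955459206503000503343497459501000,
    501633500095499776410213520177504442498423501654496662503559534785549441479132499215499987499941500307499520499104500386499089499538499954499997499936500477499678500940500495500925499757500008500108499925499804499976499182498957499119500750500069499766499926500263500940501113501158499680500191521216501178499228502327519580494080524812491434527011500730494508545393522591502445453065493989462683491100516162512296532483504550488438497499494810493178542414496949459135503006503349497454501002,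
    501463498298501720410244520170504441498647501355496461503858534773549424479139499296500058499947500263499599499232500266499231499600500819500061499952500401499736500770500401500769499739499938499173500067499259499915499369498894499065501257499929499693500017500199501019501206501158499680500274521208501177499229502326519573494082524804491437527001500730494510545377522584502444453081493991462696491103516156512291532472504548488442497500494812493181542399496950459150503005503348497455501001,
    501679503062496584410460520121504430498279501912495285504998534689549305479189499193499871499940500335499458499022500530498985499504498527499890499917500533499628501086500579501049499823500123501643499700499397500082498989498526498755501342500043499413500363499952501320501562501155499681500591521157501174499230502320519526494096524744491458526936500728494523545268522529502438453194494006462786491124516117512262532394504537488470497506494825493197542297496958459248502997503340497461500999,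
    501375495585504643410077520207504449498824501073496012504294534838549516479100499339500165499951500229499669499332500123499352499645502124500159499971500335499791500610500310500630499685499833497767500274499309500392499225498753498947501292499724499588500146500107501134501342501160499680500393521248501180499227502330519609494071524850491421527052500731494500545461522626502449452993493980462627491086516186512314532532504556488421497496494802493168542478496945459073503010503354497451501003,
    501522500123499754410357520144504435498528501545496762503564534729549362479165499268499987499945500286499552499164500362499150499569499941499996499940500445499699500878500462500863499775500009500118499927499800499979499235498988499145501234500067499763499930500260500941501114501157499681500194521182501176499230502323519548494090524773491448526968500729494517545320522555502441453140493999462743491114516136512276532431504542488457497503494819493189542346496954459201503001503344497458501000,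
    501234505581494426410575520095504424498623501642495527504762534645549242479216499407499775499956500268499547499218500539499166499611497315499799499920500441499680500933500504500881499952500201502681500105499371500180499066498602498819501323499942499470500293500001501258501489501154499681500527521130501173499231502317519501494104524712491469526902500727494530545210522500502435453254494014462834491136516097512246532352504531488485497510494831493206542243496962459300502993503336497465500998,
    499945496664503589412010519773504353500644500625496050504248534089548452479549500026500131500002499875499974500366499837500119500279501605500120500021499968499878500355499730500549500198499871498273500253499329500364499227498765498957501268499750499585500157500095501122501328501135499687500398520791501154499244502280519188494199524315491606526470500715494618544484522139502396454004494110463430491278515838512049531833504458488670497550494914493315541565497010459953502945503282497505500982,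
    501103495790504443410444520125504431499169500988496019504285534696549314479185499469500158499960500162499727499528500069499498499765502025500152499981500266499808500561500303500531500223499840497863500270499313500387499226498756498949501288499729499587500148500105501132501340501155499681500394521161501175499230502321519529494095524748491456526941500728494522545276522533502439453185494005462779491123516120512264532400504538488468497506494824493196542305496957459241502998503340497461500999,
    501103495790504443410444520125504431499945500213496019504285534696549314479185499469500158499960500011499570499969500069499498500152502025500152499981500423499959500121499917500531500223499840497863500270499313500387499226498756498949501288499729499587500148500105501132501340501155499681500394521161501175499230502321519529494095524748491456526941500728494522545276522533502439453185494005462779491123516120512264532400504538488468497506494824493196542305496957459241502998503340497461500999,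
    500759500903499489410697520068504418498989501355495785504512534598549175479244499635499672499973500197499642499426500549499359499725499565499967500236500342499736500769500425500703500089500018500246500188499343500284499149498682498887501302499834499530500219500053501191501410501152499682500459521101501171499233502314519474494112524678491481526865500726494538545148522470502432453318494022462884491148516075512229532308504525488500497513494838493215542185496966459356502989503331497468500996,
    502261494915505296408878520477504508498470500575495988504323535302550176478821498912500186499919500298499710499131500300498876500024502446500183499940500333499888500327500104500513500248499809497452500288499296500410499225498746498941501308499707499589500139500114501141501351501176499675500391521531501195499217502361519871493992525181491307527412500741494426546068522927502481452367493900462128490967516402512478532966504617488266497462494733493077543044496904458528503050503399497417501017,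
    500832495995504243410811520042504413499333501085496026504276534553549112479271499600500152499970500130499731499621500558499540499832501927500144499990500250499789500616500350500535500217499847497959500266499316500382499226498758498951501283499734499587500150500102501129501337501151499682500395521074501170499234502311519449494119524647491491526831500725494545545090522441502429453377494029462932491159516054512214532267504519488515497516494845493224542131496970459408502986503327497471500995]

/-- The rows for the ordinates of an approximate inverse of the Jacobian of the distance and mirror
equations, packed in the same way as `newtonX`. -/
def newtonY : List ℕ :=
  [
    500000500000500000500000500000500000500000500000500000500000500000500000501000500000500000500000500000500000500000500000500000500000500000500000500000500000500000500000500000500000500000500000500000500000500000500000500000500000500000500000500000500000500000500000500000500000500000500000500000500000500000500000500000500000500000500000500000500000500000500000500000500000500000500000500000500000500000500000500000500000500000500000500000500000500000500000500000500000500000500000500000500000,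
    500000500000500000500000500000500000500000500000500000500000500000501000500000500000500000500000500000500000500000500000500000500000500000500000500000500000500000500000500000500000500000500000500000500000500000500000500000500000500000500000500000500000500000500000500000500000500000500000500000500000500000500000500000500000500000500000500000500000500000500000500000500000500000500000500000500000500000500000500000500000500000500000500000500000500000500000500000500000500000500000500000500000,
    500000500000500000500000500000500000500000500000500000500000501000500000500000500000500000500000500000500000500000500000500000500000500000500000500000500000500000500000500000500000500000500000500000500000500000500000500000500000500000500000500000500000500000500000500000500000500000500000500000500000500000500000500000500000500000500000500000500000500000500000500000500000500000500000500000500000500000500000500000500000500000500000500000500000500000500000500000500000500000500000500000500000,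
    500000500000500000500000500000500000500000500000500000501000500000500000500000500000500000500000500000500000500000500000500000500000500000500000500000500000500000500000500000500000500000500000500000500000500000500000500000500000500000500000500000500000500000500000500000500000500000500000500000500000500000500000500000500000500000500000500000500000500000500000500000500000500000500000500000500000500000500000500000500000500000500000500000500000500000500000500000500000500000500000500000500000,
    500000500000500000500000500000500000500000500000501000500000500000500000500000500000500000500000500000500000500000500000500000500000500000500000500000500000500000500000500000500000500000500000500000500000500000500000500000500000500000500000500000500000500000500000500000500000500000500000500000500000500000500000500000500000500000500000500000500000500000500000500000500000500000500000500000500000500000500000500000500000500000500000500000500000500000500000500000500000500000500000500000500000,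
    500000500000500000500000500000500000500000501000500000500000500000500000500000500000500000500000500000500000500000500000500000500000500000500000500000500000500000500000500000500000500000500000500000500000500000500000500000500000500000500000500000500000500000500000500000500000500000500000500000500000500000500000500000500000500000500000500000500000500000500000500000500000500000500000500000500000500000500000500000500000500000500000500000500000500000500000500000500000500000500000500000500000,
    500000500000500000500000500000500000501000500000500000500000500000500000500000500000500000500000500000500000500000500000500000500000500000500000500000500000500000500000500000500000500000500000500000500000500000500000500000500000500000500000500000500000500000500000500000500000500000500000500000500000500000500000500000500000500000500000500000500000500000500000500000500000500000500000500000500000500000500000500000500000500000500000500000500000500000500000500000500000500000500000500000500000,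
    500027500013499985498589500296501091499973500028499933500071500551500781499663499987499999499999500005499992499985500007499985499992499994500000499999500008499995500016500008500016499996500001500007499998499991500000499986499979499982500019500002499990499998500000500019500022500017499988500008500335500013499984500033500310499906500390499861500424500016499911500708500351500043499263499909499412499870500255500194500502500067499831499961499916499890500660499943499368500042500051499949500012,
    500027500012499985498593501293500090499974500028499934500071500549500781499663499987499999499999500005499992499985500007499985499992499994500000499999500008499995500016500008500016499996500001500007499998499991500000499986499979499982500019500002499990499998500000500019500022500017499988500008500334500013499984500033500309499906500389499861500423500016499911500709500350500043499262499911499409499870500255500194500504500074499831499963499916499890500662499943499365500043500052499948500020,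
    500022500010499987499588500323500068499978500023499945500058500541500783499672499989499999499999500004499993499988500006499987499994499995500000499999500007499995500013500007500013499997500000500006499998499993500000499988499983499985500016500002499992499999500000500015500018500014499990500007500329500011499987500035500304499908500382499862500432500013499914500721500361500040499253499903499407499858500256500195500517500073499815499959499918499893500674499952499349500049500054499961500015,
    500036499996500991498591500317500070499966500036499921500083500546500776499673499983500000499999500007499990499981500008499980499990500002500000499999500010499993500020500011500020499995500009499999499999499991499999499983499975499979500021500003499990500007499998500022500026500018499995500011500333500018499988500037500307499907500389499866500424500011499914500712500355500038499263499906499414499860500254500193500510500071499819499961499919499893500666499952499359500047500053499960500016,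
    500003500928500086498599500315500069499991500016499939500066500543500771499674499998499993500000500002499996499995500009499993499998500040499994499999500004499997500009500005500008500004499997499959500004499989500006499988499981499984500020499995499994500002500002500017500021500018499995500006500331500018499988500036500305499908500387499866500421500011499914500708500352500038499268499906499418499861500252500192500507500071499820499961499919499894500662499952499363500047500052499960500016,
    501011500115499894498595500316500070499977500027499929500076500544500774499673499990499997500009500004499993499987500008499986499993499944499996500009500007499995500015500008500014499999500004500051500001499990500002499985499978499981500021499999499991500005500000500020500024500018499995500009500332500018499988500036500306499907500388499866500423500011499914500710500354500038499265499906499416499861500253500192500508500071499819499961499919499893500664499952499360500047500052499960500016,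
    499989499995500007499361499736500914500011499988500028499970500253500939499810500005500000500000499998500003500006499997500006500003500003500000500000499997500002499993499996499993500002500000499997500001500004500000500006500009500007499992499999500004500001500000499992499991499993500005499997500156499994500007500030500143499957500177499927500192499990499968501104500151500031498886500298498836500061500307500234500902499940500151500230499953499938501062499623499102499623499792499476500206,
    500007500003499996498989500202500803499993500007499982500019500397500863499739499997500000500000500001499998499996500002499996499998499998500000500000500002499999500004500002500004499999500000500002499999499998500000499996499994499995500005500001499997500000500000500005500006500004499997500002500243500004499996500031500223499933500279499895500304500003499940500913500247500037499068500111499113499868500282500215500709500046499884500129499935499915500868499862499117500121499906499540500181,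
    499978499990500013499571500065500383500021499977500054499943500172500983499850500011500001500001499996500007500012499994500012500006500005500000500001499993500004499987499993499987500003500000499994500002500007500000500011500017500014499984499998500008500001500000499985499982499986500010499993500108499989500013500030500097499971500118499945500129499982499983501213500096500028498782500404498679499865500321500244501011500015499963500373499963499951501171499743498753500236500268499781500086,
    500037500017499979498382500963500621499963500039499908500098500631500738499623499982499999499999500007499989499979500010499979499989499992499999499998500011499992500022500012500022499995500001500010499997499988500000499980499971499976500027500003499987499998499999500026500031500023499983500011500383500019499978500033500355499893500447499843500487500024499895500601500405500047499365499805499566499552500241500184500395500217499448499964499906499877500552499679499497500001500091499644500140,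
    500015500007499991500840500347498799499985500016499963500039499667498765502565499993500000499999500003499996499992500004499992499996499997500000499999500004499997500009500005500009499998500000500004499999499995500000499992499988499990500011500001499995499999500000500010500012500009499993500005499794500007499991499960499813500057499768500096499747500014500042498548499802499959501465499608501530499919499596499693498814500078499801499697500638500838498278500495501181500496500273500688499729,
    500008500004499995498964500827500201499992500009499979500022500406500858499734499996500000500000500002499997499995500002499995499998499998500000500000500002499998500005500003500005499999500000500002499999499997500000499996499994499995500006500001499997499999500000500006500007500005499996500003500248500004499995500032500229499931500286499893500312500003499938500901500254500037499080500098499132499868500280500213500697500186499526499901499934499913500855499867499133500116500134499885500045,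
    499988499995500007499364500733499913500011499988500029499970500252500940499810500006500000500000499998500003500006499997500007500003500003500000500000499997500002499993499996499993500002500000499997500001500004500000500006500009500008499992499999500004500001500000499992499991499993500005499997500156499994500007500030500142499957500176499927500191499990499968501106500150500031498884499726499067499691500307500234500904500165499580499859499953499938501064499996498882500195500164500050499980,
    499989499995500007499361499736500914500011499988500028499970500253502700498049500005500000500000499998500003500006499997500006500003500003500000500000499997500002499993499996499993500002500000499997500001500004500000500006500009500007499992499999500004500001500000499992499991499993500005499997500156499994500007500030500143499957500177499927500192499990499968501104500151500031498886500298498836500061500883500672500653499940500151500230499515499362501310499623499102499623499792499476500206,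
    500109500051499937499288500609500005499893500114499730500287500263501049499665499947499997499996500021499967499939500028499938499969499976499998499995500033499978500065500034500063499985500002500030499992499964500000499943499915499929500078500008499961499993499998500076500090500068499951500033500151500054499935499953500148499955500197499971500214500080499921501089500623500123498813499790499093499739500343500261500837500137499651499898499917499890501033499963498957500135500123499997500001,
    500341500158499805499142500139500415499666500356499156500896500285501666498976499836499992499988500065499897499810500087499806499903499924499994499986500102499931500202500107500198499953500007500094499974499888500000499821499736499777500244500025499877499978499995500237500280500211499848500103500142500169499796499804500160499952500237500056500258499831499703501153500333499871498992500045499088499917500545500414500651500031499920500061499745499665501031499814499151499887499958499762500094,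
    500448500207499744499075500262500264499561500467498892501176500294501353499257499784499989499984500085499865499751500114499745499872499900499993499981500133499909500265500140500260499938500009500123499966499853500000499765499654499707500320500032499839499971499993500311500368500277499800500136500137500222499733499736500166499950500256500095500278500334499789501040500388499822499024499969499165499873500442500336500650500059499850500010499815499757500946499872499166499967500009499849500060,
    499922499964500045499933499995500141500076499919500193499795500860500477499680500037500002500003499985500023500043499980500044500022500017500001500003499977500016499954499976499955500011499998499979500006500026500000500041500060500051499944499994500028500005500001499946499936499952500035499976500535499961500046500129500484499854500018500045500020499936499906500299500060499946499759500033499768499994500156500119500150499999500003500029499920499895500262499940499800499950499975499919500032,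
    500103500048499941499740500042500126499899500108499745500271500784500504499690499950499998499996500020499969499943500026499941499971499977499998499996500031499979500061500032500060499986500002500028499992499966500000499946499920499933500074500007499963499993499998500072500085500064499954500031500043500051499938500111500441499867500072500017500078499949499910500349500101499961499695500014499724499975500165500125500197500009499976500018499923499899500312499944499743499966499987499928500028,
    500925500428499471498865500255500056499094500964497714502428500440500625499736499555499978499967500176499722499485500236499474499736499794499985499961500275499812500547500289500536499872500019500255499929499696500000499515499285499396500661500067499668499941499986500641500759500572499587500280500268500015499990500029500247499925500314499892500341500009499931500574500286500031499407499924499528499888500204500155500411500057499854499968499934499914500536499961499484500038500042499968500013,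
    501040499740500202498647500304500067499006501031498213501795500524500745499686499500500004499963500193499699499435500232499428499708500125500009499961500299499799500586500308500579499837499993499903499976500041499973499497499441499528500275500020500022499968499762500474500561500017499995499974500320500018499988500035500295499911500374499871500407500011499917500684500340500037499293499909499438499866500244500185500489500069499826499962499922499897500639499954499384500045500050499962500015,
    501082499490500467498568500322500071498974501056498394501566500555500789499667499479500014499961500200499691499417500230499411499698500245500018499961500307499795500600500315500594499825499983499775499993500166499964499490499498499576500135500003500150499978499681500414500490500018499995500421500338500019499988500037500312499906500396499863500431500012499912500724500360500039499251499904499405499858500258500196500518500073499816499960499917499891500677499951499348500048500053499959500016,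
    498768500308499761501602499640499921501177498779502116500058499380499118500372500592499995500044499771500356500668499726500677500345499852499989500046499646500238499306499635499315500192500009500115500028499952500031500596500661500559499675499976499974500038499969500015500018499979500006500030499622499979500014499958499651500106499557500153499518499987500098499190499597499956500837500107500666500159499712499781499421499919500206500045500093500122499243500054500729499946499940500045499982,
    500904495553504712498389500362500080499278500596499365500624500624500887499626499565500169499967500140499808499590500012499615499778502139500160499990500198499884500338500168500363499755499830497733500296500052499825499805499802499832500065499703499859500167499885500165500195500021499994500158500381500021499986500042500351499894500445499846500485500013499901500814500405500044499158499892499331499840500290500221500583500082499793499955499907499878500761499945499267500054500060499954500018,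
    500887495176505119498372500366500081499308500552499458500534500631500896499622499573500184499968500135499819499607499991499634499785502321500174499992500187499893500313500154500341499749499816497538500325500041499812499835499831499857500058500196499882500140499904500141500167500021499994500133500385500021499986500042500355499893500450499845500490500013499900500823500410500044499149499891499323499839500293500223500589500082499790499955499906499876500769499945499259500054500061499954500018,
    501024499227500755498615500311500069499039500978499973500033500536500762499678499508500024499963500187499713499454500205499451499717500372500028499964500287499810500556500291500552499827499973499637500015499985500020499999499991499993500017499981500002499992500009500009500010500018499995499997500327500018499988500036500302499909500383499868500417500011499915500700500348500038499276499907499425499863500249500190500501500070499822499961499920499895500654499953499370500046500052499961500015,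
    501040499740500202498647500304500067499006501031500057499951500524500745499686499500500004499963500193499699499435500232499428499708500125500009499961500299499799500586500308500579499837499993499903499976500041499973499497500018500015500011500020500022499968500026499987499985500017499995499974500320500018499988500035500295499911500374499871500407500011499917500684500340500037499293499909499438499866500244500185500489500069499826499962499922499897500639499954499384500045500050499962500015,
    499955500452500600498612500312500069500028499987499965500041500538500764499677500022499983500002499995500006500016500010500013500009499782499984499999499994500003499992499997499990500018499978499711500013499986500017499997499989499991500018499984500000499995500007500011500013500018499995499999500328500018499988500036500303499908500384499868500418500011499915500702500349500038499274499907499423499862500250500190500502500070499821499961499920499895500656499953499368500046500052499961500015,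
    500512499613500377499308500156500034499691500818499986500017500268500381499839499754500012499982500060499822499824500102499725499944500186500014499982500155499841500464500083499992500011499986499819500008499993500010500000499996499996500009499991500001499996500004500004500005500009499998499998500164500009499994500018500151499954500191499934500208500006499958500350500174500019499638499954499712499931500125500095500250500035499911499981499960499947500327499976499685500023500026499980500008,
    499530500355499653500636499857499969500941500510500013499985499754499650500148500226499989500017499817500031500535499906500252500379499829499987500016499903499901500290500252500007499990500012500167499993500007499991500000500004500003499992500009499999500004499996499996499995499992500002500001499850499992500005499984499861500042499824500061499809499995500039499678499840499983500332500043500264500063499886499913499770499968500082500018500037500048499700500022500289499979499976500018499993,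
    501494498872501101497979500454500100499098500468499960500048500783501113499530499281500036499946500176499479499488500299499199499836500543500041499948499885499909500266500242499977500032499960499470500023499979500029499999499987499989500025499973500002499989500013500013500015500026499993499996500477500027499983500052500441499867500558499807500608500016499876501022500508500055498944499865499160499800500364500277500731500102499740499944499883499846500954499931499080500068500075499943500023,
    500873509506490800498376500365500080499319500543499466500526500629500894499622499580500181499969500133499822499613499991499640499789495427499658500479500184499894500308500151500335499753500331504425499852500041499815499837499833499859500058500193499883500138499906500139500164500021499994500131500384500021499986500042500354499893500449499845500489500013499901500821500409500044499151499891499325499839500292500222500588500082499791499955499906499877500767499945499261500054500061499954500018,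
    500512499613500377499308500156500034500348500160499986500017500268500381499839499754500012499982499932500016500198500102499725499944500186500014499982499961499969500091500083499992500011499986499819500008499993500010500000499996499996500009499991500001499996500004500004500005500009499998499998500164500009499994500018500151499954500191499934500208500006499958500350500174500019499638499954499712499931500125500095500250500035499911499981499960499947500327499976499685500023500026499980500008,
    501024499227500755498615500311500069500039499978499973500033500536500762499678499508500024499963499992500009500022500010500019500013500372500028499964499991500004499987499995499984500022499973499637500015499985500020499999499991499993500017499981500002499992500009500009500010500018499995499997500327500018499988500036500302499909500383499868500417500011499915500700500348500038499276499907499425499863500249500190500501500070499822499961499920499895500654499953499370500046500052499961500015]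

/-- The digit at position `l` of a packed row. -/
def unpack (N l : ℕ) : ℤ := (N / 10 ^ (6 * l) % 10 ^ 6 : ℕ) - 500000

def vertX (i : ℕ) : ℤ := approxX.getD i 0

def vertY (i : ℕ) : ℤ := approxY.getD i 0

def slopeX (i l : ℕ) : ℤ := unpack (newtonX.getD i 0) l

def slopeY (i l : ℕ) : ℤ := unpack (newtonY.getD i 0) l

def edgeAt (k : ℕ) : ℕ × ℕ := wedgeEdges.getD k (0, 0)

/-- `cos (π/200)`, in units of `10⁻¹²`. -/
def approxCos : ℤ := 999876632482

/-- `sin (π/200)`, in units of `10⁻¹²`. -/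
def approxSin : ℤ := 15707317312

theorem edgeAt_lt : ∀ k < 69, (edgeAt k).1 < 41 ∧ (edgeAt k).2 < 41 := by decide +kernel

theorem sum_slopeX_le : ∀ i < 41, ∑ l ∈ Finset.range 82, (slopeX i l).natAbs ≤ 800000 := by
  decide +kernel

theorem sum_slopeY_le : ∀ i < 41, ∑ l ∈ Finset.range 82, (slopeY i l).natAbs ≤ 800000 := by
  decide +kernel

theorem residual_edge_le : ∀ k < 69,
    ((vertX (edgeAt k).1 - vertX (edgeAt k).2) ^ 2 + (vertY (edgeAt k).1 - vertY (edgeAt k).2) ^ 2 -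
      10 ^ 24).natAbs ≤ 5 * 10 ^ 14 := by
  decide +kernel

theorem jacobian_edge_le : ∀ k < 69, ∑ l ∈ Finset.range 82, ((if l = k then 10 ^ 15 else 0) -
    2 * ((vertX (edgeAt k).1 - vertX (edgeAt k).2) *
        (slopeX (edgeAt k).1 l - slopeX (edgeAt k).2 l) +
      (vertY (edgeAt k).1 - vertY (edgeAt k).2) *
        (slopeY (edgeAt k).1 l - slopeY (edgeAt k).2 l)) : ℤ).natAbs ≤ 25 * 10 ^ 13 := by
  decide +kernel

theorem vertY_lower : ∀ i < 7, vertY i = 0 := by decide +kernel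

theorem jacobian_lower_le : ∀ k < 82, 69 ≤ k → k < 76 → ∑ l ∈ Finset.range 82,
    ((if l = k then 10 ^ 3 else 0) - slopeY (k - 69) l : ℤ).natAbs ≤ 250 := by
  decide +kernel

theorem residual_upper_le : ∀ i < 13, 7 ≤ i →
    (approxCos * vertY i - approxSin * vertX i).natAbs ≤ 10 ^ 14 := by
  decide +kernel

theorem jacobian_upper_le : ∀ k < 82, 76 ≤ k → ∑ l ∈ Finset.range 82,
    ((if l = k then 10 ^ 15 else 0) -
      (approxCos * slopeY (k - 69) l - approxSin * slopeX (k - 69) l) : ℤ).natAbs ≤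
        25 * 10 ^ 13 := by
  decide +kernel

theorem abs_cos_sin_taylor_sub_le {x : ℝ} (h0 : 0 ≤ x) (h1 : x ≤ 1) :
    |Real.cos x - (1 - x ^ 2 / 2 + x ^ 4 / 24)| ≤ x ^ 6 / 300 ∧
      |Real.sin x - (x - x ^ 3 / 6 + x ^ 5 / 120)| ≤ x ^ 6 / 300 := by
  have h := Complex.exp_bound (x := x * Complex.I) (n := 6)
    (by simpa [abs_of_nonneg h0] using h1) (by norm_num)
  have hI2 : Complex.I ^ 2 = -1 := Complex.I_sq
  have e : Complex.exp (x * Complex.I) -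
      ∑ m ∈ Finset.range 6, (x * Complex.I : ℂ) ^ m / (m.factorial : ℂ) =
      ((Real.cos x - (1 - x ^ 2 / 2 + x ^ 4 / 24) : ℝ) : ℂ) +
        ((Real.sin x - (x - x ^ 3 / 6 + x ^ 5 / 120) : ℝ) : ℂ) * Complex.I := by
    rw [Complex.exp_mul_I]
    simp only [Finset.sum_range_succ, Finset.sum_range_zero, Nat.factorial]
    push_cast
    linear_combination (-(x : ℂ) ^ 2 / 2 - (x : ℂ) ^ 3 / 6 * Complex.I -
      (x : ℂ) ^ 4 / 24 * (Complex.I ^ 2 - 1) -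
      (x : ℂ) ^ 5 / 120 * Complex.I * (Complex.I ^ 2 - 1)) * hI2
  rw [e] at h
  have hb : ‖(x * Complex.I : ℂ)‖ ^ 6 * ((Nat.succ 6 : ℕ) * ((Nat.factorial 6 : ℕ) * (6 : ℕ) : ℝ)⁻¹) ≤
      x ^ 6 / 300 := by
    have : ‖(x * Complex.I : ℂ)‖ = x := by simp [abs_of_nonneg h0]
    rw [this, div_eq_mul_inv]
    refine mul_le_mul_of_nonneg_left ?_ (by positivity)
    norm_num [Nat.factorial]
  have h' := h.trans hb
  refine ⟨(le_trans ?_ (Complex.abs_re_le_norm _)).trans h',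
    (le_trans ?_ (Complex.abs_im_le_norm _)).trans h'⟩
  · rw [Complex.add_re, Complex.re_ofReal_mul, Complex.ofReal_re, Complex.I_re, mul_zero, add_zero]
  · rw [Complex.add_im, Complex.im_ofReal_mul, Complex.ofReal_im, Complex.I_im, mul_one, zero_add]

theorem abs_cos_sin_sub_le : |Real.cos (Real.pi / 200) - approxCos / 10 ^ 12| ≤ 1 / 10 ^ 12 ∧
    |Real.sin (Real.pi / 200) - approxSin / 10 ^ 12| ≤ 1 / 10 ^ 12 := by
  have hl := Real.pi_gt_d20
  have hu := Real.pi_lt_d20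
  set x := Real.pi / 200 with hx
  have h1 : (0.0157079632679489 : ℝ) < x := by rw [hx]; linarith
  have h2 : x < (0.0157079632679490 : ℝ) := by rw [hx]; linarith
  have h0 : 0 < x := by linarith
  obtain ⟨hc, hs⟩ := abs_cos_sin_taylor_sub_le h0.le (by linarith)
  have p2l : (0.0157079632679489 : ℝ) ^ 2 < x ^ 2 := by gcongr
  have p2u : x ^ 2 < (0.0157079632679490 : ℝ) ^ 2 := by gcongr
  have p3l : (0.0157079632679489 : ℝ) ^ 3 < x ^ 3 := by gcongr
  have p3u : x ^ 3 < (0.0157079632679490 : ℝ) ^ 3 := by gcongr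
  have p4l : (0.0157079632679489 : ℝ) ^ 4 < x ^ 4 := by gcongr
  have p4u : x ^ 4 < (0.0157079632679490 : ℝ) ^ 4 := by gcongr
  have p5l : (0.0157079632679489 : ℝ) ^ 5 < x ^ 5 := by gcongr
  have p5u : x ^ 5 < (0.0157079632679490 : ℝ) ^ 5 := by gcongr
  have p6u : x ^ 6 < (0.0157079632679490 : ℝ) ^ 6 := by gcongr
  rw [abs_le] at hc hs ⊢
  rw [abs_le]
  norm_num [approxCos, approxSin] at *
  refine ⟨⟨?_, ?_⟩, ?_, ?_⟩ <;> linarith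

theorem sum_abs_le_of_natAbs {f : ℕ → ℤ} {N B : ℕ}
    (h : ∑ l ∈ Finset.range N, (f l).natAbs ≤ B) {D : ℝ} (hD : 0 < D) :
    ∑ l : Fin N, |(f l : ℝ) / D| ≤ B / D := by
  rw [Fin.sum_univ_eq_sum_range (fun l => |(f l : ℝ) / D|), le_div_iff₀ hD, Finset.sum_mul]
  calc ∑ l ∈ Finset.range N, |(f l : ℝ) / D| * D
      = ∑ l ∈ Finset.range N, ((f l).natAbs : ℝ) := by
        refine Finset.sum_congr rfl fun l _ => ?_
        rw [abs_div, abs_of_pos hD, div_mul_cancel₀ _ hD.ne', Nat.cast_natAbs, Int.cast_abs]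
    _ ≤ B := by exact_mod_cast h

theorem abs_div_le_of_natAbs {a : ℤ} {B : ℕ} (h : a.natAbs ≤ B) {D : ℝ} (hD : 0 < D) :
    |(a : ℝ) / D| ≤ B / D := by
  rw [abs_div, abs_of_pos hD]
  gcongr
  rw [← Int.cast_abs, ← Nat.cast_natAbs]
  exact_mod_cast h

/-- The abscissa of a wedge vertex, corrected along the Newton directions. -/
def coordX (u : Fin 82 → ℝ) (i : ℕ) : ℝ :=
  vertX i / 10 ^ 12 + ∑ l : Fin 82, (slopeX i l / 10 ^ 3) * u l

/-- The ordinate of a wedge vertex, corrected along the Newton directions. -/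
def coordY (u : Fin 82 → ℝ) (i : ℕ) : ℝ :=
  vertY i / 10 ^ 12 + ∑ l : Fin 82, (slopeY i l / 10 ^ 3) * u l

/-- The distance and mirror equations for the wedge. -/
def wedgeEquations (u : Fin 82 → ℝ) (k : Fin 82) : ℝ :=
  if k.val < 69 then (coordX u (edgeAt k).1 - coordX u (edgeAt k).2) ^ 2 +
    (coordY u (edgeAt k).1 - coordY u (edgeAt k).2) ^ 2 - 1
  else if k.val < 76 then coordY u (k - 69)
  else Real.cos (Real.pi / 200) * coordY u (k - 69) - Real.sin (Real.pi / 200) * coordX u (k - 69)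

theorem coordX_sub (u : Fin 82 → ℝ) (i j : ℕ) : coordX u i - coordX u j =
    ((vertX i - vertX j : ℤ) : ℝ) / 10 ^ 12 +
      ∑ l : Fin 82, ((slopeX i l - slopeX j l : ℤ) : ℝ) / 10 ^ 3 * u l := by
  simp only [coordX, Int.cast_sub, sub_div, sub_mul, Finset.sum_sub_distrib]
  ring

theorem coordY_sub (u : Fin 82 → ℝ) (i j : ℕ) : coordY u i - coordY u j =
    ((vertY i - vertY j : ℤ) : ℝ) / 10 ^ 12 +
      ∑ l : Fin 82, ((slopeY i l - slopeY j l : ℤ) : ℝ) / 10 ^ 3 * u l := by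
  simp only [coordY, Int.cast_sub, sub_div, sub_mul, Finset.sum_sub_distrib]
  ring

theorem sum_abs_sub_le {f g : ℕ → ℤ} (hf : ∑ l ∈ Finset.range 82, (f l).natAbs ≤ 800000)
    (hg : ∑ l ∈ Finset.range 82, (g l).natAbs ≤ 800000) :
    ∑ l : Fin 82, |((f l - g l : ℤ) : ℝ) / 10 ^ 3| ≤ 1600 := by
  refine (sum_abs_le_of_natAbs (f := fun l => f l - g l) (B := 1600000) ?_ (by positivity)).trans
    (by norm_num)
  calc _ ≤ ∑ l ∈ Finset.range 82, ((f l).natAbs + (g l).natAbs) :=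
        Finset.sum_le_sum fun l _ => Int.natAbs_sub_le _ _
    _ ≤ _ := by rw [Finset.sum_add_distrib]; omega

theorem vert_upper_le : ∀ i < 13, (vertX i).natAbs ≤ 190 * 10 ^ 12 ∧
    (vertY i).natAbs ≤ 10 * 10 ^ 12 := by
  decide +kernel

theorem wedgeEquations_zero_le (k : Fin 82) : |wedgeEquations 0 k| ≤ 1 / 10 ^ 9 / 2 := by
  unfold wedgeEquations
  split_ifs with h1 h2
  · simp only [coordX_sub, coordY_sub, Pi.zero_apply, mul_zero, Finset.sum_const_zero, add_zero]
    refine le_trans (le_of_eq ?_) ((abs_div_le_of_natAbs (residual_edge_le k h1)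
      (show (0 : ℝ) < 10 ^ 24 by positivity)).trans (by norm_num))
    push_cast
    congr 1
    ring
  · simp only [coordY, vertY_lower _ (show k.val - 69 < 7 by omega), Pi.zero_apply, mul_zero,
      Finset.sum_const_zero, Int.cast_zero, zero_div, add_zero, abs_zero]
    positivity
  · have hk : k.val - 69 < 13 := by omega
    have h3 := abs_div_le_of_natAbs (residual_upper_le _ hk (by omega))
      (show (0 : ℝ) < 10 ^ 24 by positivity)
    have h4 := abs_div_le_of_natAbs (vert_upper_le _ hk).1 (show (0 : ℝ) < 10 ^ 12 by positivity)
    have h5 := abs_div_le_of_natAbs (vert_upper_le _ hk).2 (show (0 : ℝ) < 10 ^ 12 by positivity)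
    obtain ⟨h6, h7⟩ := abs_cos_sin_sub_le
    simp only [coordX, coordY, Pi.zero_apply, mul_zero, Finset.sum_const_zero, add_zero]
    set c := Real.cos (Real.pi / 200)
    set s := Real.sin (Real.pi / 200)
    set x := (vertX (k - 69) : ℝ) with hx
    set y := (vertY (k - 69) : ℝ) with hy
    have e : c * (y / 10 ^ 12) - s * (x / 10 ^ 12) =
        ((approxCos * vertY (k - 69) - approxSin * vertX (k - 69) : ℤ) : ℝ) / 10 ^ 24 +
        (c - approxCos / 10 ^ 12) * (y / 10 ^ 12) - (s - approxSin / 10 ^ 12) * (x / 10 ^ 12) := by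
      push_cast
      rw [← hx, ← hy]
      ring
    rw [e]
    have h8 := mul_le_mul h6 (h5.trans (show _ ≤ (10 : ℝ) by norm_num)) (abs_nonneg _)
      (by positivity)
    have h9 := mul_le_mul h7 (h4.trans (show _ ≤ (190 : ℝ) by norm_num)) (abs_nonneg _)
      (by positivity)
    rw [← abs_mul] at h8 h9
    refine ((abs_sub _ _).trans (add_le_add ((abs_add_le _ _).trans (add_le_add h3 h8)) h9)).trans
      ?_
    norm_num

theorem wedgeEquations_near_identity (u v : Fin 82 → ℝ) (H : ℝ) (hu : ∀ l, |u l| ≤ 1 / 10 ^ 9)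
    (hv : ∀ l, |v l| ≤ 1 / 10 ^ 9) (hH : ∀ l, |u l - v l| ≤ H) (k : Fin 82) :
    |(u k - v k) - (wedgeEquations u k - wedgeEquations v k)| ≤ 1 / 2 * H := by
  have hH0 := (abs_nonneg _).trans (hH k)
  unfold wedgeEquations
  split_ifs with h1 h2
  · obtain ⟨ha, hb⟩ := edgeAt_lt k h1
    simp only [coordX_sub, coordY_sub]
    refine (abs_sub_quadratic_le (σ := 1 / 4) (M := 1600) ?_
      (sum_abs_sub_le (sum_slopeX_le _ ha) (sum_slopeX_le _ hb))
      (sum_abs_sub_le (sum_slopeY_le _ ha) (sum_slopeY_le _ hb)) hu hv hH).trans ?_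
    · refine le_trans (le_of_eq ?_) ((sum_abs_le_of_natAbs (jacobian_edge_le k h1)
        (show (0 : ℝ) < 10 ^ 15 by positivity)).trans (by norm_num))
      refine Finset.sum_congr rfl fun l _ => ?_
      congr 1
      simp only [Fin.ext_iff]
      split_ifs <;> push_cast <;> ring
    · exact mul_le_mul_of_nonneg_right (by norm_num) hH0
  · refine (abs_sub_linear_le (σ := 1 / 4) ?_ hH).trans
      (mul_le_mul_of_nonneg_right (by norm_num) hH0)
    refine le_trans (le_of_eq ?_) ((sum_abs_le_of_natAbs (jacobian_lower_le k k.2 (by omega) h2)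
      (show (0 : ℝ) < 10 ^ 3 by positivity)).trans (by norm_num))
    refine Finset.sum_congr rfl fun l _ => ?_
    congr 1
    simp only [Fin.ext_iff]
    split_ifs <;> push_cast <;> ring
  · obtain ⟨h6, h7⟩ := abs_cos_sin_sub_le
    set c := Real.cos (Real.pi / 200)
    set s := Real.sin (Real.pi / 200)
    have e : ∀ w : Fin 82 → ℝ, c * coordY w (k - 69) - s * coordX w (k - 69) =
        (c * (vertY (k - 69) / 10 ^ 12) - s * (vertX (k - 69) / 10 ^ 12)) +
        ∑ l : Fin 82, (c * (slopeY (k - 69) l / 10 ^ 3) - s * (slopeX (k - 69) l / 10 ^ 3)) *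
          w l := by
      intro w
      simp only [coordX, coordY, sub_mul, Finset.sum_sub_distrib, mul_assoc, ← Finset.mul_sum]
      ring
    rw [e, e]
    refine (abs_sub_linear_le (σ := 1 / 2) ?_ hH)
    have hk : k.val - 69 < 41 := by omega
    have g1 := sum_abs_le_of_natAbs (sum_slopeX_le _ hk) (show (0 : ℝ) < 10 ^ 3 by positivity)
    have g2 := sum_abs_le_of_natAbs (sum_slopeY_le _ hk) (show (0 : ℝ) < 10 ^ 3 by positivity)
    have g3 := sum_abs_le_of_natAbs (jacobian_upper_le k k.2 (by omega))
      (show (0 : ℝ) < 10 ^ 15 by positivity)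
    refine le_trans (Finset.sum_le_sum fun l _ => ?_) (?_ : ∑ l : Fin 82,
      (|(((if l.val = k.val then 10 ^ 15 else 0) - (approxCos * slopeY (k - 69) l -
          approxSin * slopeX (k - 69) l) : ℤ) : ℝ) / 10 ^ 15| +
        1 / 10 ^ 12 * |(slopeY (k - 69) l : ℝ) / 10 ^ 3| +
        1 / 10 ^ 12 * |(slopeX (k - 69) l : ℝ) / 10 ^ 3|) ≤ 1 / 2)
    · have e2 : ((if l = k then 1 else 0) -
          (c * (slopeY (k - 69) l / 10 ^ 3) - s * (slopeX (k - 69) l / 10 ^ 3)) : ℝ) =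
          (((if l.val = k.val then 10 ^ 15 else 0) - (approxCos * slopeY (k - 69) l -
            approxSin * slopeX (k - 69) l) : ℤ) : ℝ) / 10 ^ 15 -
          (c - approxCos / 10 ^ 12) * (slopeY (k - 69) l / 10 ^ 3) +
          (s - approxSin / 10 ^ 12) * (slopeX (k - 69) l / 10 ^ 3) := by
        simp only [Fin.ext_iff]
        split_ifs <;> push_cast <;> ring
      rw [e2]
      refine (abs_add_le _ _).trans (add_le_add ((abs_sub _ _).trans (add_le_add le_rfl ?_)) ?_)
      · rw [abs_mul]
        gcongr
      · rw [abs_mul]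
        gcongr
    · simp only [Finset.sum_add_distrib, ← Finset.mul_sum]
      refine (add_le_add (add_le_add g3 (mul_le_mul_of_nonneg_left g2 (by positivity)))
        (mul_le_mul_of_nonneg_left g1 (by positivity))).trans (by norm_num)

/-- The approximate wedge is close to an exact solution of the distance and mirror equations. -/
theorem exists_wedge_coordinates : ∃ x y : ℕ → ℝ,
    (∀ i < 41, |x i - vertX i / 10 ^ 12| ≤ 1 / 10 ^ 6 ∧ |y i - vertY i / 10 ^ 12| ≤ 1 / 10 ^ 6) ∧
    (∀ k < 69, (x (edgeAt k).1 - x (edgeAt k).2) ^ 2 + (y (edgeAt k).1 - y (edgeAt k).2) ^ 2 = 1) ∧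
    (∀ i < 7, y i = 0) ∧
    ∀ i < 13, 7 ≤ i → Real.cos (Real.pi / 200) * y i = Real.sin (Real.pi / 200) * x i := by
  obtain ⟨u, hu, hF⟩ := exists_zero_of_near_identity wedgeEquations
    (show (0 : ℝ) < 1 / 10 ^ 9 by positivity) wedgeEquations_zero_le wedgeEquations_near_identity
  refine ⟨coordX u, coordY u, fun i hi => ⟨?_, ?_⟩, fun k hk => ?_, fun i hi => ?_,
    fun i hi hi' => ?_⟩
  · rw [coordX, add_sub_cancel_left]
    have h := sum_abs_le_of_natAbs (sum_slopeX_le i hi) (show (0 : ℝ) < 10 ^ 3 by positivity)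
    exact (abs_sum_mul_le h (by positivity) hu).trans (by norm_num)
  · rw [coordY, add_sub_cancel_left]
    have h := sum_abs_le_of_natAbs (sum_slopeY_le i hi) (show (0 : ℝ) < 10 ^ 3 by positivity)
    exact (abs_sum_mul_le h (by positivity) hu).trans (by norm_num)
  · have h := hF ⟨k, by omega⟩
    rw [wedgeEquations, if_pos hk] at h
    linarith
  · have h := hF ⟨i + 69, by omega⟩
    rw [wedgeEquations, if_neg (by simp), if_pos (by simp; omega)] at h
    simpa using h
  · have h := hF ⟨i + 69, by omega⟩
    rw [wedgeEquations, if_neg (by simp), if_neg (by simp; omega)] at h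
    simpa [sub_eq_zero] using h

/-- The neighbours of each wedge vertex. -/
def neighbourList : List (List ℕ) :=
  [[13, 17], [17, 20], [22, 25], [27, 29], [29, 33], [35, 37], [37, 39], [14, 15], [15, 18],
    [21, 24], [31, 34], [34, 38], [38, 40], [0, 14, 16, 17], [7, 13, 15, 16], [7, 8, 14, 18],
    [13, 14, 18, 19], [0, 1, 13, 20], [8, 15, 16, 19], [16, 18, 21, 23], [1, 17, 22, 23],
    [9, 19, 23, 24], [2, 20, 23, 25], [19, 20, 21, 22], [9, 21, 25, 26], [2, 22, 24, 26],
    [24, 25, 27, 28], [3, 26, 28, 29], [26, 27, 30, 31], [3, 4, 27, 33], [28, 31, 32, 33],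
    [10, 28, 30, 34], [30, 33, 35, 36], [4, 29, 30, 32], [10, 11, 31, 38], [5, 32, 36, 37],
    [32, 35, 39, 40], [5, 6, 35, 39], [11, 12, 34, 40], [6, 36, 37, 40], [12, 36, 38, 39]]

/-- Two wedge vertices joined by an edge. -/
def WedgeAdj (a b : Fin 41) : Prop := b.val ∈ neighbourList.getD a.val []

instance : DecidableRel WedgeAdj := fun _ _ => inferInstanceAs (Decidable (_ ∈ _))

theorem WedgeAdj.symm : ∀ {a b}, WedgeAdj a b → WedgeAdj b a := by decide +kernel

theorem WedgeAdj.exists_edgeAt : ∀ {a b}, WedgeAdj a b →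
    ∃ k < 69, edgeAt k = (a.val, b.val) ∨ edgeAt k = (b.val, a.val) := by
  decide +kernel

/-- The triangles of the wedge, as triples of vertices. -/
def triangleList : List (Fin 41 × Fin 41 × Fin 41) :=
  [(15, 7, 14), (14, 13, 16), (17, 13, 0), (15, 18, 8), (20, 17, 1), (18, 16, 19), (19, 23, 21),
    (23, 20, 22), (9, 21, 24), (22, 2, 25), (25, 26, 24), (27, 28, 26), (27, 3, 29), (31, 28, 30),
    (33, 29, 4), (33, 32, 30), (31, 34, 10), (36, 32, 35), (35, 5, 37), (34, 38, 11),
    (36, 39, 40), (6, 39, 37), (12, 38, 40)]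

def wedgeTriangles : Finset (Finset (Fin 41)) :=
  (triangleList.map fun p => {p.1, p.2.1, p.2.2}).toFinset

theorem card_wedgeTriangles : wedgeTriangles.card = 23 := by decide +kernel

theorem mem_wedgeTriangles_of_adj : ∀ a b, WedgeAdj a b → ∀ c, WedgeAdj a c → WedgeAdj b c →
    {a, b, c} ∈ wedgeTriangles := by
  decide +kernel

theorem adj_of_mem_triangleList {p : Fin 41 × Fin 41 × Fin 41} (h : p ∈ triangleList) :
    WedgeAdj p.1 p.2.1 ∧ WedgeAdj p.1 p.2.2 ∧ WedgeAdj p.2.1 p.2.2 := by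
  have h' : triangleList.all fun p =>
      WedgeAdj p.1 p.2.1 ∧ WedgeAdj p.1 p.2.2 ∧ WedgeAdj p.2.1 p.2.2 := by
    decide +kernel
  simpa using List.all_eq_true.1 h' p h

theorem exists_wedgeAdj_common : ∀ a b, WedgeAdj a b → ∃ c, WedgeAdj a c ∧ WedgeAdj b c := by
  decide +kernel

theorem neighbourList_spec : ∀ a < 41, (neighbourList.getD a []).Nodup ∧
    (neighbourList.getD a []).length = (if a < 13 then 2 else 4) ∧
      ∀ b ∈ neighbourList.getD a [], b < 41 := by
  decide +kernel

theorem ncard_wedgeAdj (a : Fin 41) : {b | WedgeAdj a b}.ncard = if a.val < 13 then 2 else 4 := by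
  obtain ⟨h1, h2, h3⟩ := neighbourList_spec a a.2
  rw [← Set.ncard_image_of_injective _ Fin.val_injective, ← h2, ← List.toFinset_card_of_nodup h1,
    ← Set.ncard_coe_finset]
  congr 1
  ext b
  simp only [Set.mem_image, Set.mem_ofPred_eq, List.coe_toFinset]
  exact ⟨fun ⟨c, hc, h⟩ => h ▸ hc, fun h => ⟨⟨b, h3 b h⟩, h, rfl⟩⟩

theorem not_mirror_of_wedgeAdj : ∀ a b, WedgeAdj a b → a.val < 13 → ¬ b.val < 13 := by
  decide +kernel

theorem vertX_bounds : ∀ i < 41, 174 * 10 ^ 12 ≤ vertX i ∧ vertX i ≤ 184 * 10 ^ 12 := by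
  decide +kernel

theorem vertY_bounds : ∀ i < 41, 0 ≤ vertY i ∧ vertY i ≤ 3 * 10 ^ 12 := by
  decide +kernel

theorem vertY_pos : ∀ i < 41, 7 ≤ i → 10 ^ 11 ≤ vertY i := by
  decide +kernel

theorem vert_below_upper : ∀ i < 41, i < 7 ∨ 13 ≤ i →
    approxCos * vertY i - approxSin * vertX i ≤ -10 ^ 23 := by
  decide +kernel

theorem vert_separated : ∀ i < 41, ∀ j < i,
    10 ^ 10 ≤ |vertX i - vertX j| ∨ 10 ^ 10 ≤ |vertY i - vertY j| := by
  decide +kernel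

theorem vert_bent_interior : ∀ a : Fin 41, ¬ a.val < 13 → ∀ b, WedgeAdj a b → ∀ c, WedgeAdj a c →
    10 ^ 10 ≤ |vertX b + vertX c - 2 * vertX a| ∨ 10 ^ 10 ≤ |vertY b + vertY c - 2 * vertY a| := by
  decide +kernel

theorem vert_bent_mirror : ∀ a : Fin 41, a.val < 13 → ∀ b, WedgeAdj a b → ∀ c, WedgeAdj a c →
    10 ^ 24 ≤ |vertX a * (vertX b + vertX c - 2 * vertX a) +
      vertY a * (vertY b + vertY c - 2 * vertY a)| := by
  decide +kernel

/-- The orientation of three approximate wedge vertices. -/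
def vertOrient (a b c : ℕ) : ℤ :=
  (vertX b - vertX a) * (vertY c - vertY a) - (vertY b - vertY a) * (vertX c - vertX a)

/-- The edge `cd` meets the line through the edge `ab` in at most a common endpoint. -/
def SideTest (a b c d : ℕ) : Prop :=
  (10 ^ 21 ≤ vertOrient a b c ∧ 10 ^ 21 ≤ vertOrient a b d) ∨
  (vertOrient a b c ≤ -10 ^ 21 ∧ vertOrient a b d ≤ -10 ^ 21) ∨
  ((c = a ∨ c = b) ∧ 10 ^ 21 ≤ |vertOrient a b d|) ∨
  ((d = a ∨ d = b) ∧ 10 ^ 21 ≤ |vertOrient a b c|)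

instance (a b c d : ℕ) : Decidable (SideTest a b c d) :=
  inferInstanceAs (Decidable (_ ∨ _))

theorem sideTest_wedgeEdges : ∀ k < 69, ∀ l < k,
    SideTest (edgeAt k).1 (edgeAt k).2 (edgeAt l).1 (edgeAt l).2 ∨
      SideTest (edgeAt l).1 (edgeAt l).2 (edgeAt k).1 (edgeAt k).2 := by
  decide +kernel
/-- The orientation of a triple of points of the plane. -/
def orient (p q r : ℂ) : ℝ := (q.re - p.re) * (r.im - p.im) - (q.im - p.im) * (r.re - p.re)

theorem orient_affine (p q r r' : ℂ) {s t : ℝ} (h : s + t = 1) :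
    orient p q (s • r + t • r') = s * orient p q r + t * orient p q r' := by
  obtain rfl : s = 1 - t := by linarith
  simp only [orient, Complex.add_re, Complex.add_im, Complex.real_smul, Complex.re_ofReal_mul,
    Complex.im_ofReal_mul]
  ring

theorem orient_eq_zero_of_mem_segment {p q z : ℂ} (hz : z ∈ segment ℝ p q) :
    orient p q z = 0 := by
  obtain ⟨s, t, -, -, hst, rfl⟩ := hz
  rw [orient_affine _ _ _ _ hst]
  simp only [orient]
  ring

theorem endpoint_of_orient_ne_zero {p q r r' z : ℂ} (hr : r = p ∨ r = q)
    (hr' : orient p q r' ≠ 0) (hz : z ∈ segment ℝ p q) (hz' : z ∈ segment ℝ r r') : z = r := by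
  have hr0 : orient p q r = 0 :=
    orient_eq_zero_of_mem_segment (by
      rcases hr with rfl | rfl
      exacts [left_mem_segment _ _ _, right_mem_segment _ _ _])
  have h0 := orient_eq_zero_of_mem_segment hz
  obtain ⟨s, t, -, -, hst, rfl⟩ := hz'
  rw [orient_affine _ _ _ _ hst, hr0, mul_zero, zero_add, mul_eq_zero] at h0
  obtain rfl : t = 0 := h0.resolve_right hr'
  obtain rfl : s = 1 := by linarith
  simp

theorem orient_mul_nonpos {p q r r' z : ℂ} (hz : z ∈ segment ℝ p q) (hz' : z ∈ segment ℝ r r') :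
    orient p q r * orient p q r' ≤ 0 := by
  have h0 := orient_eq_zero_of_mem_segment hz
  obtain ⟨s, t, hs, ht, hst, rfl⟩ := hz'
  rw [orient_affine _ _ _ _ hst] at h0
  by_contra! h
  rcases hs.eq_or_lt with rfl | hs
  · obtain rfl : t = 1 := by linarith
    rw [zero_mul, zero_add, one_mul] at h0
    simp [h0] at h
  · have h1 : s * (orient p q r * orient p q r') + t * orient p q r' ^ 2 = 0 := by
      linear_combination orient p q r' * h0
    linarith [mul_pos hs h, mul_nonneg ht (sq_nonneg (orient p q r'))]

/-- Coordinates within `10⁻⁶` of the approximate wedge. -/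
def NearWedge (x y : ℕ → ℝ) : Prop :=
  ∀ i < 41, |x i - vertX i / 10 ^ 12| ≤ 1 / 10 ^ 6 ∧ |y i - vertY i / 10 ^ 12| ≤ 1 / 10 ^ 6

theorem abs_mul_sub_mul_le {p q p₀ q₀ δ M : ℝ} (hp : |p - p₀| ≤ δ) (hq : |q - q₀| ≤ δ)
    (hp₀ : |p₀| ≤ M) (hq₀ : |q₀| ≤ M) : |p * q - p₀ * q₀| ≤ δ * (2 * M + δ) := by
  have hδ := (abs_nonneg _).trans hp
  have e : p * q - p₀ * q₀ = (p - p₀) * (q - q₀) + (p - p₀) * q₀ + p₀ * (q - q₀) := by ring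
  rw [e]
  refine ((abs_add_le _ _).trans (add_le_add (abs_add_le _ _) le_rfl)).trans ?_
  simp only [abs_mul]
  have h1 := mul_le_mul hp hq (abs_nonneg _) hδ
  have h2 := mul_le_mul hp hq₀ (abs_nonneg _) hδ
  have h3 := mul_le_mul hp₀ hq (abs_nonneg _) ((abs_nonneg _).trans hp₀)
  linarith

theorem ne_of_le_abs {a b : ℝ} {m : ℤ} (h : 10 ^ 10 ≤ |m|)
    (hab : |a - b - m / 10 ^ 12| ≤ 4 / 10 ^ 6) : a ≠ b := by
  rintro rfl
  have h' : (10 ^ 10 : ℝ) ≤ |(m : ℝ)| := by exact_mod_cast h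
  rw [sub_self, zero_sub, abs_neg, abs_div, abs_of_pos (show (0 : ℝ) < 10 ^ 12 by positivity),
    div_le_iff₀ (by positivity)] at hab
  norm_num at *
  linarith

namespace NearWedge

variable {x y : ℕ → ℝ}

theorem bounds (h : NearWedge x y) {i : ℕ} (hi : i < 41) :
    (173 ≤ x i ∧ x i ≤ 185) ∧ -1 ≤ y i ∧ y i ≤ 4 := by
  obtain ⟨h1, h2⟩ := vertX_bounds i hi
  obtain ⟨h3, h4⟩ := vertY_bounds i hi
  obtain ⟨h5, h6⟩ := h i hi
  have h1' : (174 * 10 ^ 12 : ℝ) ≤ vertX i := by exact_mod_cast h1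
  have h2' : (vertX i : ℝ) ≤ 184 * 10 ^ 12 := by exact_mod_cast h2
  have h3' : (0 : ℝ) ≤ vertY i := by exact_mod_cast h3
  have h4' : (vertY i : ℝ) ≤ 3 * 10 ^ 12 := by exact_mod_cast h4
  rw [abs_le] at h5 h6
  refine ⟨⟨?_, ?_⟩, ?_, ?_⟩ <;> linarith

theorem sub_le (h : NearWedge x y) {i j : ℕ} (hi : i < 41) (hj : j < 41) :
    |(x i - x j) - (vertX i - vertX j : ℤ) / 10 ^ 12| ≤ 2 / 10 ^ 6 ∧
      |(y i - y j) - (vertY i - vertY j : ℤ) / 10 ^ 12| ≤ 2 / 10 ^ 6 := by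
  obtain ⟨h1, h2⟩ := h i hi
  obtain ⟨h3, h4⟩ := h j hj
  simp only [abs_le] at *
  push_cast
  refine ⟨⟨?_, ?_⟩, ?_, ?_⟩ <;> linarith

theorem add_sub_two_mul_le (h : NearWedge x y) {i j k : ℕ} (hi : i < 41) (hj : j < 41)
    (hk : k < 41) :
    |(x j + x k - 2 * x i) - (vertX j + vertX k - 2 * vertX i : ℤ) / 10 ^ 12| ≤ 4 / 10 ^ 6 ∧
      |(y j + y k - 2 * y i) - (vertY j + vertY k - 2 * vertY i : ℤ) / 10 ^ 12| ≤ 4 / 10 ^ 6 := by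
  obtain ⟨h1, h2⟩ := h i hi
  obtain ⟨h3, h4⟩ := h j hj
  obtain ⟨h5, h6⟩ := h k hk
  simp only [abs_le] at *
  push_cast
  refine ⟨⟨?_, ?_⟩, ?_, ?_⟩ <;> linarith

theorem vert_sub_le {i j : ℕ} (hi : i < 41) (hj : j < 41) :
    |((vertX i - vertX j : ℤ) : ℝ) / 10 ^ 12| ≤ 10 ∧
      |((vertY i - vertY j : ℤ) : ℝ) / 10 ^ 12| ≤ 10 := by
  obtain ⟨h1, h2⟩ := vertX_bounds i hi
  obtain ⟨h3, h4⟩ := vertY_bounds i hi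
  obtain ⟨h5, h6⟩ := vertX_bounds j hj
  obtain ⟨h7, h8⟩ := vertY_bounds j hj
  have hX : |vertX i - vertX j| ≤ 10 * 10 ^ 12 := by rw [abs_le]; constructor <;> linarith
  have hY : |vertY i - vertY j| ≤ 10 * 10 ^ 12 := by rw [abs_le]; constructor <;> linarith
  have hd : (0 : ℝ) < 10 ^ 12 := by positivity
  rw [abs_div, abs_div, abs_of_pos hd, div_le_iff₀ hd, div_le_iff₀ hd]
  exact ⟨by exact_mod_cast hX, by exact_mod_cast hY⟩

theorem vert_add_sub_two_mul_le {i j k : ℕ} (hi : i < 41) (hj : j < 41) (hk : k < 41) :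
    |(vertX i : ℝ) / 10 ^ 12| ≤ 200 ∧ |(vertY i : ℝ) / 10 ^ 12| ≤ 200 ∧
      |((vertX j + vertX k - 2 * vertX i : ℤ) : ℝ) / 10 ^ 12| ≤ 200 ∧
      |((vertY j + vertY k - 2 * vertY i : ℤ) : ℝ) / 10 ^ 12| ≤ 200 := by
  obtain ⟨h1, h2⟩ := vertX_bounds i hi
  obtain ⟨h3, h4⟩ := vertY_bounds i hi
  obtain ⟨h5, h6⟩ := vertX_bounds j hj
  obtain ⟨h7, h8⟩ := vertY_bounds j hj
  obtain ⟨h9, h10⟩ := vertX_bounds k hk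
  obtain ⟨h11, h12⟩ := vertY_bounds k hk
  have key : ∀ m : ℤ, |m| ≤ 200 * 10 ^ 12 → |(m : ℝ) / 10 ^ 12| ≤ 200 := by
    intro m hm
    have hd : (0 : ℝ) < 10 ^ 12 := by positivity
    rw [abs_div, abs_of_pos hd, div_le_iff₀ hd]
    exact_mod_cast hm
  refine ⟨key _ ?_, key _ ?_, key _ ?_, key _ ?_⟩ <;> rw [abs_le] <;> constructor <;> linarith

theorem orient_sub_lt (h : NearWedge x y) {a b c : ℕ} (ha : a < 41) (hb : b < 41) (hc : c < 41) :
    |orient ⟨x a, y a⟩ ⟨x b, y b⟩ ⟨x c, y c⟩ - vertOrient a b c / 10 ^ 24| < 1 / 10 ^ 3 := by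
  have h1 := abs_mul_sub_mul_le (h.sub_le hb ha).1 (h.sub_le hc ha).2 (vert_sub_le hb ha).1
    (vert_sub_le hc ha).2
  have h2 := abs_mul_sub_mul_le (h.sub_le hb ha).2 (h.sub_le hc ha).1 (vert_sub_le hb ha).2
    (vert_sub_le hc ha).1
  have e : (vertOrient a b c : ℝ) / 10 ^ 24 =
      ((vertX b - vertX a : ℤ) : ℝ) / 10 ^ 12 * (((vertY c - vertY a : ℤ) : ℝ) / 10 ^ 12) -
      ((vertY b - vertY a : ℤ) : ℝ) / 10 ^ 12 * (((vertX c - vertX a : ℤ) : ℝ) / 10 ^ 12) := by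
    simp only [vertOrient]
    push_cast
    ring
  rw [e, orient, sub_sub_sub_comm]
  exact ((abs_sub _ _).trans (add_le_add h1 h2)).trans_lt (by norm_num)

theorem orient_pos (h : NearWedge x y) {a b c : ℕ} (ha : a < 41) (hb : b < 41) (hc : c < 41)
    (ho : 10 ^ 21 ≤ vertOrient a b c) : 0 < orient ⟨x a, y a⟩ ⟨x b, y b⟩ ⟨x c, y c⟩ := by
  have h1 := abs_lt.1 (h.orient_sub_lt ha hb hc)
  have h2 : (10 ^ 21 : ℝ) ≤ vertOrient a b c := by exact_mod_cast ho
  linarith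

theorem orient_neg (h : NearWedge x y) {a b c : ℕ} (ha : a < 41) (hb : b < 41) (hc : c < 41)
    (ho : vertOrient a b c ≤ -10 ^ 21) : orient ⟨x a, y a⟩ ⟨x b, y b⟩ ⟨x c, y c⟩ < 0 := by
  have h1 := abs_lt.1 (h.orient_sub_lt ha hb hc)
  have h2 : (vertOrient a b c : ℝ) ≤ -10 ^ 21 := by exact_mod_cast ho
  linarith

theorem orient_ne_zero (h : NearWedge x y) {a b c : ℕ} (ha : a < 41) (hb : b < 41) (hc : c < 41)
    (ho : 10 ^ 21 ≤ |vertOrient a b c|) : orient ⟨x a, y a⟩ ⟨x b, y b⟩ ⟨x c, y c⟩ ≠ 0 := by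
  rcases le_abs.1 ho with ho | ho
  · exact (h.orient_pos ha hb hc ho).ne'
  · exact (h.orient_neg ha hb hc (by linarith)).ne

theorem endpoint_of_sideTest (h : NearWedge x y) {a b c d : ℕ} (ha : a < 41) (hb : b < 41)
    (hc : c < 41) (hd : d < 41) (ht : SideTest a b c d) {z : ℂ}
    (hz : z ∈ segment ℝ (⟨x a, y a⟩ : ℂ) ⟨x b, y b⟩)
    (hz' : z ∈ segment ℝ (⟨x c, y c⟩ : ℂ) ⟨x d, y d⟩) :
    (z = ⟨x a, y a⟩ ∨ z = ⟨x b, y b⟩) ∧ (z = ⟨x c, y c⟩ ∨ z = ⟨x d, y d⟩) := by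
  have hle := orient_mul_nonpos hz hz'
  rcases ht with ⟨h1, h2⟩ | ⟨h1, h2⟩ | ⟨h1, h2⟩ | ⟨h1, h2⟩
  · exact absurd hle (mul_pos (h.orient_pos ha hb hc h1) (h.orient_pos ha hb hd h2)).not_ge
  · exact absurd hle
      (mul_pos_of_neg_of_neg (h.orient_neg ha hb hc h1) (h.orient_neg ha hb hd h2)).not_ge
  · have hr : (⟨x c, y c⟩ : ℂ) = ⟨x a, y a⟩ ∨ (⟨x c, y c⟩ : ℂ) = ⟨x b, y b⟩ := by
      rcases h1 with rfl | rfl <;> simp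
    have hzc := endpoint_of_orient_ne_zero hr (h.orient_ne_zero ha hb hd h2) hz hz'
    exact ⟨hzc ▸ hr, Or.inl hzc⟩
  · have hr : (⟨x d, y d⟩ : ℂ) = ⟨x a, y a⟩ ∨ (⟨x d, y d⟩ : ℂ) = ⟨x b, y b⟩ := by
      rcases h1 with rfl | rfl <;> simp
    have hzd := endpoint_of_orient_ne_zero hr (h.orient_ne_zero ha hb hc h2) hz
      (by rwa [segment_symm])
    exact ⟨hzd ▸ hr, Or.inr hzd⟩

theorem endpoint_of_ne (h : NearWedge x y) {k l : ℕ} (hk : k < 69) (hl : l < 69) (hkl : k ≠ l)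
    {z : ℂ} (hz : z ∈ segment ℝ (⟨x (edgeAt k).1, y (edgeAt k).1⟩ : ℂ)
      ⟨x (edgeAt k).2, y (edgeAt k).2⟩)
    (hz' : z ∈ segment ℝ (⟨x (edgeAt l).1, y (edgeAt l).1⟩ : ℂ)
      ⟨x (edgeAt l).2, y (edgeAt l).2⟩) :
    (z = ⟨x (edgeAt k).1, y (edgeAt k).1⟩ ∨ z = ⟨x (edgeAt k).2, y (edgeAt k).2⟩) ∧
      (z = ⟨x (edgeAt l).1, y (edgeAt l).1⟩ ∨ z = ⟨x (edgeAt l).2, y (edgeAt l).2⟩) := by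
  obtain ⟨h1, h2⟩ := edgeAt_lt k hk
  obtain ⟨h3, h4⟩ := edgeAt_lt l hl
  have ht : SideTest (edgeAt k).1 (edgeAt k).2 (edgeAt l).1 (edgeAt l).2 ∨
      SideTest (edgeAt l).1 (edgeAt l).2 (edgeAt k).1 (edgeAt k).2 := by
    rcases hkl.lt_or_gt with hlt | hlt
    · exact (sideTest_wedgeEdges l hl k hlt).symm
    · exact sideTest_wedgeEdges k hk l hlt
  rcases ht with ht | ht
  · exact h.endpoint_of_sideTest h1 h2 h3 h4 ht hz hz'
  · exact (h.endpoint_of_sideTest h3 h4 h1 h2 ht hz' hz).symm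

theorem endpoint_of_wedgeAdj (h : NearWedge x y) {a b c d : Fin 41} (hab : WedgeAdj a b)
    (hcd : WedgeAdj c d) (hne : ({a, b} : Set (Fin 41)) ≠ {c, d}) {z : ℂ}
    (hz : z ∈ segment ℝ (⟨x a, y a⟩ : ℂ) ⟨x b, y b⟩)
    (hz' : z ∈ segment ℝ (⟨x c, y c⟩ : ℂ) ⟨x d, y d⟩) :
    (z = ⟨x a, y a⟩ ∨ z = ⟨x b, y b⟩) ∧ (z = ⟨x c, y c⟩ ∨ z = ⟨x d, y d⟩) := by
  obtain ⟨k, hk, hek⟩ := hab.exists_edgeAt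
  obtain ⟨l, hl, hel⟩ := hcd.exists_edgeAt
  have hkl : k ≠ l := by
    rintro rfl
    apply hne
    rcases hek with hek | hek <;> rw [hek] at hel <;>
      simp only [Prod.mk.injEq, Fin.val_inj] at hel <;>
      rcases hel with ⟨rfl, rfl⟩ | ⟨rfl, rfl⟩ <;> first | rfl | exact Set.pair_comm _ _
  have key := h.endpoint_of_ne hk hl hkl (z := z)
  rcases hek with hek | hek <;> rcases hel with hel | hel <;> rw [hek, hel] at key
  · exact key hz hz'
  · exact (key hz (by rwa [segment_symm])).imp_right Or.symm
  · exact (key (by rwa [segment_symm]) hz').imp_left Or.symm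
  · exact (key (by rwa [segment_symm]) (by rwa [segment_symm])).imp Or.symm Or.symm

theorem injective (h : NearWedge x y) :
    Function.Injective fun i : Fin 41 => (⟨x i, y i⟩ : ℂ) := by
  have key : ∀ i j : Fin 41, j < i → (⟨x i, y i⟩ : ℂ) ≠ ⟨x j, y j⟩ := by
    intro i j hij he
    obtain ⟨h1, h2⟩ := h.sub_le i.2 j.2
    rcases vert_separated i i.2 j hij with hs | hs
    · exact ne_of_le_abs hs (h1.trans (by norm_num)) (congrArg Complex.re he)
    · exact ne_of_le_abs hs (h2.trans (by norm_num)) (congrArg Complex.im he)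
  intro i j hij
  rcases lt_trichotomy i j with hlt | heq | hlt
  · exact absurd hij.symm (key j i hlt)
  · exact heq
  · exact absurd hij (key i j hlt)

theorem bent_interior (h : NearWedge x y) {a b c : Fin 41} (ha : ¬ a.val < 13)
    (hab : WedgeAdj a b) (hac : WedgeAdj a c) :
    (⟨x b, y b⟩ : ℂ) + ⟨x c, y c⟩ ≠ 2 * ⟨x a, y a⟩ := by
  intro he
  obtain ⟨h1, h2⟩ := h.add_sub_two_mul_le a.2 b.2 c.2
  rcases vert_bent_interior a ha b hab c hac with hs | hs
  · exact ne_of_le_abs hs h1 (by simpa using congrArg Complex.re he)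
  · exact ne_of_le_abs hs h2 (by simpa using congrArg Complex.im he)

theorem bent_mirror (h : NearWedge x y) {a b c : Fin 41} (ha : a.val < 13)
    (hab : WedgeAdj a b) (hac : WedgeAdj a c) :
    inner ℝ (⟨x a, y a⟩ : ℂ) (⟨x b, y b⟩ + ⟨x c, y c⟩ - 2 * ⟨x a, y a⟩) ≠ 0 := by
  have e : inner ℝ (⟨x a, y a⟩ : ℂ) (⟨x b, y b⟩ + ⟨x c, y c⟩ - 2 * ⟨x a, y a⟩) =
      x a * (x b + x c - 2 * x a) + y a * (y b + y c - 2 * y a) := by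
    simp [Complex.inner, mul_comm]
  rw [e]
  obtain ⟨h1, h2⟩ := h.add_sub_two_mul_le a.2 b.2 c.2
  obtain ⟨h3, h4⟩ := h a a.2
  obtain ⟨hX, hY, hX', hY'⟩ := vert_add_sub_two_mul_le a.2 b.2 c.2
  have h5 := abs_mul_sub_mul_le (h3.trans (by norm_num)) h1 hX hX'
  have h6 := abs_mul_sub_mul_le (h4.trans (by norm_num)) h2 hY hY'
  have hv := vert_bent_mirror a ha b hab c hac
  have hv' : (1 : ℝ) ≤ |(vertX a : ℝ) / 10 ^ 12 *
      (((vertX b + vertX c - 2 * vertX a : ℤ) : ℝ) / 10 ^ 12) +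
      (vertY a : ℝ) / 10 ^ 12 *
        (((vertY b + vertY c - 2 * vertY a : ℤ) : ℝ) / 10 ^ 12)| := by
    rw [div_mul_div_comm, div_mul_div_comm, ← add_div, ← pow_add, abs_div,
      abs_of_pos (show (0 : ℝ) < 10 ^ (12 + 12) by positivity), le_div_iff₀ (by positivity)]
    exact_mod_cast hv
  intro h0
  rw [abs_le] at h5 h6
  rcases le_abs.1 hv' with hv' | hv' <;> norm_num at h5 h6 hv' <;> linarith

end NearWedge
theorem inSector_of_nearWedge {x y : ℕ → ℝ} (h : NearWedge x y) (h0 : ∀ i < 7, y i = 0)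
    (h1 : ∀ i < 13, 7 ≤ i → Real.cos (Real.pi / 200) * y i = Real.sin (Real.pi / 200) * x i)
    {i : ℕ} (hi : i < 41) :
    InSector 200 ⟨x i, y i⟩ ∧ (OnMirror 200 ⟨x i, y i⟩ ↔ i < 13) := by
  obtain ⟨⟨hx, -⟩, -⟩ := h.bounds hi
  have hpos : 7 ≤ i → 0 < y i := by
    intro h7
    have h2 : (10 ^ 11 : ℝ) ≤ vertY i := by exact_mod_cast vertY_pos i hi h7
    have h3 := abs_le.1 (h i hi).2
    linarith
  have hlt : i < 7 ∨ 13 ≤ i → Real.cos (Real.pi / 200) * y i < Real.sin (Real.pi / 200) * x i := by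
    intro h7
    have h2 : ((approxCos * vertY i - approxSin * vertX i : ℤ) : ℝ) ≤ (-10 ^ 23 : ℤ) := by
      exact_mod_cast vert_below_upper i hi h7
    push_cast at h2
    obtain ⟨hc, hs⟩ := abs_cos_sin_sub_le
    obtain ⟨h3, h4⟩ := h i hi
    obtain ⟨hX, hY, -, -⟩ := NearWedge.vert_add_sub_two_mul_le hi hi hi
    have h5 := abs_le.1 (abs_mul_sub_mul_le (hc.trans (by norm_num)) h4
      (show _ ≤ (200 : ℝ) by norm_num [approxCos, abs_of_pos]) hY)
    have h6 := abs_le.1 (abs_mul_sub_mul_le (hs.trans (by norm_num)) h3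
      (show _ ≤ (200 : ℝ) by norm_num [approxSin, abs_of_pos]) hX)
    have h8 : (approxCos : ℝ) / 10 ^ 12 * (vertY i / 10 ^ 12) -
        approxSin / 10 ^ 12 * (vertX i / 10 ^ 12) ≤ -1 / 10 := by
      rw [div_mul_div_comm, div_mul_div_comm, ← sub_div, div_le_iff₀ (by positivity)]
      linarith
    linarith
  have hcast : ((200 : ℕ) : ℝ) = 200 := by norm_num
  simp only [InSector, OnMirror, hcast]
  by_cases h13 : i < 13
  · by_cases h7 : i < 7
    · have hlt' := hlt (Or.inl h7)
      exact ⟨⟨by linarith, (h0 i h7).ge, hlt'.le⟩, by simp [h13, h0 i h7]⟩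
    · have h7' : 7 ≤ i := by omega
      exact ⟨⟨by linarith, (hpos h7').le, (h1 i h13 h7').le⟩, by simp [h13, h1 i h13 h7']⟩
  · have h7' : 7 ≤ i := by omega
    have h13' : 13 ≤ i := by omega
    have hlt' := hlt (Or.inr h13')
    exact ⟨⟨by linarith, (hpos h7').le, hlt'.le⟩, by simp [h13, (hpos h7').ne', hlt'.ne]⟩

theorem exists_ringWedge : ∃ W : RingWedge 200 (Fin 41), W.adj = WedgeAdj := by
  obtain ⟨x, y, hnear, hdist, hlow, hup⟩ := exists_wedge_coordinates
  have h : NearWedge x y := hnear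
  have hm : ∀ i : Fin 41, OnMirror 200 ⟨x i, y i⟩ ↔ i.val < 13 := fun i =>
    (inSector_of_nearWedge h hlow hup i.2).2
  refine ⟨{
    pos := fun i => ⟨x i, y i⟩
    adj := WedgeAdj
    symm := WedgeAdj.symm
    inSector := fun i => (inSector_of_nearWedge h hlow hup i.2).1
    injective := h.injective
    dist_eq := ?_
    not_mirror := fun {a b} hab ha => (hm b).not.2 (not_mirror_of_wedgeAdj a b hab ((hm a).1 ha))
    planar := fun hab hcd hne z hz hz' => h.endpoint_of_wedgeAdj hab hcd hne hz hz'
    degree_interior := fun a ha => by rw [ncard_wedgeAdj, if_neg ((hm a).not.1 ha)]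
    degree_mirror := fun a ha => by rw [ncard_wedgeAdj, if_pos ((hm a).1 ha)]
    bent_interior := fun {a _ _} ha hab hac => h.bent_interior ((hm a).not.1 ha) hab hac
    bent_mirror := fun {a _ _} ha hab hac => h.bent_mirror ((hm a).1 ha) hab hac
    exists_triangle := fun {a b} hab => exists_wedgeAdj_common a b hab }, rfl⟩
  intro a b hab
  obtain ⟨k, hk, hek⟩ := hab.exists_edgeAt
  have hd := hdist k hk
  rw [Complex.dist_eq_re_im, Real.sqrt_eq_one]
  rcases hek with hek | hek <;> rw [hek] at hd <;> linarith

open Real in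
/-- There exists a finite 4-regular planar straight-line
unit-distance graph consisting only of unit triangles without additional
triangles, with exactly `9200 = 100 * 92` unit triangles, invariant under the
rotation about some center by the angle `2π/100`. -/
theorem exists_planar_four_regular_ring_graph_order_100 :
    ∃ G : UnitDistGraph, ∃ c : ℂ, G.Planar ∧ G.Regular4 ∧ G.OnlyUnitTriangles ∧
      G.NoAdditionalTriangles ∧ G.triangleCount = 9200 ∧
      G.RotInvariant c (2 * π / 100) := by
  obtain ⟨W, hW⟩ := exists_ringWedge
  have h2 : 2 ≤ 200 := by norm_num
  refine ⟨W.graph, 0, RingWedge.graph_planar h2, RingWedge.graph_regular h2,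
    RingWedge.graph_onlyUnitTriangles, RingWedge.graph_noAdditionalTriangles h2, ?_,
    RingWedge.graph_rotInvariant (m := 2) (by norm_num) (by push_cast; ring)⟩
  rw [RingWedge.graph_triangleCount h2 wedgeTriangles, card_wedgeTriangles]
  intro t
  rw [hW]
  constructor
  · intro ht
    obtain ⟨p, hp, rfl⟩ := List.mem_map.1 (List.mem_toFinset.1 ht)
    obtain ⟨h1, h2, h3⟩ := adj_of_mem_triangleList hp
    exact ⟨_, _, _, h1, h2, h3, by congr!⟩
  · rintro ⟨a, b, c, hab, hac, hbc, rfl⟩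
    convert mem_wedgeTriangles_of_adj a b hab c hac hbc
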